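/- arXiv:2011.08143 — 4 statements merged into one kernel-verified Lean document; each statement's English description precedes it below -/
import Mathlib

section
/- Let A ∈ GL_n(ℚ) and let L ≤ ℤ^n ∩ A⁻¹(ℤ^n) be a finite-index subgroup with L ≠ ℤ^n and AL ≠ ℤ^n. Let H = ⟨x_1,…,x_n⟩ be the base subgroup of G := G(A,L), let K be the normal closure of H in G, and let H_1 = {g ∈ H ∣ C_G(g) ≠ H}. Then AL = L if and only if H_1 ⊆ Z(K), where Z(K) is the center of K. -/
open Matrix

noncomputable section

/-- The coercion `ℤ^n → ℚ^n` as an additive homomorphism. -/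
def ZtoQ (n : ℕ) : (Fin n → ℤ) →+ (Fin n → ℚ) :=
  AddMonoidHom.mk' (fun v i => (v i : ℚ)) (by intro a b; funext i; simp)

/-- The image `A·L ⊆ ℚ^n` of a subgroup `L ≤ ℤ^n` under the matrix `A`. -/
def QImage {n : ℕ} (A : Matrix (Fin n) (Fin n) ℚ) (L : AddSubgroup (Fin n → ℤ)) :
    AddSubgroup (Fin n → ℚ) :=
  (L.map (ZtoQ n)).map A.mulVecLin.toAddMonoidHom

/-- The subgroup `AL` of `ℤ^n`, i.e. the set of integer vectors lying in `A·L`. -/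
def ALsub {n : ℕ} (A : Matrix (Fin n) (Fin n) ℚ) (L : AddSubgroup (Fin n → ℤ)) :
    AddSubgroup (Fin n → ℤ) :=
  (QImage A L).comap (ZtoQ n)

/-- `x^v = x_1^{v_1} ⋯ x_n^{v_n}` in the free group on `x_1,…,x_n,t`. -/
def xWord (n : ℕ) (v : Fin n → ℤ) : FreeGroup (Fin n ⊕ Unit) :=
  (List.ofFn fun i => (FreeGroup.of (Sum.inl i) : FreeGroup (Fin n ⊕ Unit)) ^ (v i)).prod

/-- The relations of the Leary–Minasyan group `G(A,L)`. -/
def LMrels (n : ℕ) (A : Matrix (Fin n) (Fin n) ℚ) (L : AddSubgroup (Fin n → ℤ)) :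
    Set (FreeGroup (Fin n ⊕ Unit)) :=
  {r | (∃ i j : Fin n,
          r = FreeGroup.of (Sum.inl i) * FreeGroup.of (Sum.inl j) *
              (FreeGroup.of (Sum.inl i))⁻¹ * (FreeGroup.of (Sum.inl j))⁻¹) ∨
       (∃ v ∈ L, ∃ w : Fin n → ℤ, ZtoQ n w = A.mulVec (ZtoQ n v) ∧
          r = FreeGroup.of (Sum.inr ()) * xWord n v * (FreeGroup.of (Sum.inr ()))⁻¹ *
              (xWord n w)⁻¹)}

/-- The Leary–Minasyan group `G(A,L)`. -/
abbrev LM (n : ℕ) (A : Matrix (Fin n) (Fin n) ℚ) (L : AddSubgroup (Fin n → ℤ)) :=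
  PresentedGroup (LMrels n A L)

/-- The generator `x_i` of `G(A,L)`. -/
def Xg (n : ℕ) (A : Matrix (Fin n) (Fin n) ℚ) (L : AddSubgroup (Fin n → ℤ)) (i : Fin n) :
    LM n A L :=
  PresentedGroup.of (Sum.inl i)

/-- The stable letter `t` of `G(A,L)`. -/
def Tg (n : ℕ) (A : Matrix (Fin n) (Fin n) ℚ) (L : AddSubgroup (Fin n → ℤ)) : LM n A L :=
  PresentedGroup.of (Sum.inr ())

/-- The element `x^v` of `G(A,L)`. -/
def Xv (n : ℕ) (A : Matrix (Fin n) (Fin n) ℚ) (L : AddSubgroup (Fin n → ℤ)) (v : Fin n → ℤ) :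
    LM n A L :=
  (List.ofFn fun i => (Xg n A L i) ^ (v i)).prod

/-- The base subgroup `H = ⟨x_1,…,x_n⟩` of `G(A,L)`. -/
def Hsub (n : ℕ) (A : Matrix (Fin n) (Fin n) ℚ) (L : AddSubgroup (Fin n → ℤ)) :
    Subgroup (LM n A L) :=
  Subgroup.closure (Set.range (Xg n A L))

/-- The set `⋃_{j∈ℤ} A^j(ℤ^n) ⊆ ℚ^n`. -/
def unionSet {n : ℕ} (A : Matrix (Fin n) (Fin n) ℚ) : Set (Fin n → ℚ) :=
  ⋃ j : ℤ, (A ^ j).mulVec '' Set.range (ZtoQ n)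

/-- Cast an integer matrix to a rational matrix. -/
def QMat {k : ℕ} (M : Matrix (Fin k) (Fin k) ℤ) : Matrix (Fin k) (Fin k) ℚ :=
  M.map (Int.cast)

/-- The block matrix `[[1, 0ᵀ],[u, C]]`. -/
def blockOne {k : ℕ} (u : Fin k → ℤ) (C : Matrix (Fin k) (Fin k) ℤ) :
    Matrix (Fin (k+1)) (Fin (k+1)) ℤ :=
  Matrix.of fun i j =>
    Fin.cases (Fin.cases 1 (fun _ => 0) j) (fun i' => Fin.cases (u i') (fun j' => C i' j') j) i

/-- Transport a subgroup of `ℤ^a` along an equality `a = b` of dimensions. -/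
def reindexSub {a b : ℕ} (h : a = b) (L : AddSubgroup (Fin a → ℤ)) :
    AddSubgroup (Fin b → ℤ) :=
  L.map (AddMonoidHom.mk' (fun v => v ∘ (finCongr h).symm) (fun _ _ => rfl))

namespace HNNExtension

open NormalWord

variable {G : Type*} [Group G] {A B : Subgroup G} {φ : A ≃* B}

/-- The product of the letters `t ^ u * g` for the pairs `(u, g)` of a list. -/
def syllableProd (φ : A ≃* B) (l : List (ℤˣ × G)) : HNNExtension G A B φ :=
  (l.map fun x => t ^ (x.1 : ℤ) * of x.2).prod

theorem syllableProd_cons (a : ℤˣ × G) (l : List (ℤˣ × G)) :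
    syllableProd φ (a :: l) = t ^ (a.1 : ℤ) * of a.2 * syllableProd φ l := by
  simp [syllableProd]

/-- Every element of an HNN extension is the product of a reduced word. -/
theorem exists_reducedWord_prod_eq (x : HNNExtension G A B φ) :
    ∃ w : ReducedWord G A B, w.prod φ = x := by
  obtain ⟨d⟩ := TransversalPair.nonempty G A B
  exact ⟨((NormalWord.equiv φ d) x).toReducedWord, (NormalWord.equiv φ d).symm_apply_apply x⟩

/-- A product of a reduced word and an inverse of one, with no cancellation at the junction, is
represented by a reduced word whose length is the sum of the lengths. -/
theorem exists_reducedWord_inv_mul (l : List (ℤˣ × G)) (w : ReducedWord G A B)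
    (hl : l.IsChain fun a b => a.2 ∈ toSubgroup A B a.1 → a.1 = b.1)
    (hw : ∀ a ∈ l.head?, ∀ b ∈ w.toList.head?, w.head ∈ toSubgroup A B (-a.1) → -a.1 = b.1) :
    ∃ w' : ReducedWord G A B, w'.prod φ = (syllableProd φ l)⁻¹ * w.prod φ ∧
      w'.toList.length = l.length + w.toList.length := by
  induction l generalizing w with
  | nil => exact ⟨w, by simp [syllableProd], by simp⟩
  | cons a l ih =>
    have hc : ((-a.1, w.head) :: w.toList).IsChain
        (fun a b => a.2 ∈ toSubgroup A B a.1 → a.1 = b.1) :=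
      List.isChain_cons.2 ⟨fun b hb => hw a (by simp) b hb, w.chain⟩
    obtain ⟨w', h₁, h₂⟩ := ih ⟨a.2⁻¹, (-a.1, w.head) :: w.toList, hc⟩
      (List.isChain_cons.1 hl).2 (by
        intro b hb c hc hmem
        have hab := (List.isChain_cons.1 hl).1 b hb
        simp only [List.head?_cons, Option.mem_def, Option.some.injEq] at hc
        subst hc
        rw [inv_mem_iff] at hmem
        by_contra hne
        have hba : b.1 = -a.1 := by
          rcases Int.units_eq_one_or a.1 with h | h <;>
            rcases Int.units_eq_one_or b.1 with h' | h' <;> simp_all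
        rw [hba, neg_neg] at hmem
        exact hne (by rw [hab hmem]))
    refine ⟨w', ?_, by simp only [h₂, List.length_cons]; omega⟩
    rw [h₁, syllableProd_cons]
    simp [ReducedWord.prod, mul_assoc]

/-- If `g` lies in the base group but in neither associated subgroup, then any `x` conjugating `g`
into the base group lies in the base group. -/
theorem mem_range_of_inv_mul_mul_mem_range {g : G} (hA : g ∉ A) (hB : g ∉ B)
    (hAn : A.Normal) (hBn : B.Normal) {x : HNNExtension G A B φ}
    (h : x⁻¹ * of g * x ∈ (of : G →* HNNExtension G A B φ).range) :
    x ∈ (of : G →* HNNExtension G A B φ).range := by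
  obtain ⟨w, rfl⟩ := exists_reducedWord_prod_eq x
  have hg : ∀ u, w.head⁻¹ * g * w.head ∉ toSubgroup A B u := by
    intro u
    have hA' := hAn.mem_comm_iff (a := w.head⁻¹ * g) (b := w.head)
    have hB' := hBn.mem_comm_iff (a := w.head⁻¹ * g) (b := w.head)
    rcases Int.units_eq_one_or u with rfl | rfl <;> simp_all
  obtain ⟨w', h₁, h₂⟩ := exists_reducedWord_inv_mul (φ := φ) w.toList
    ⟨w.head⁻¹ * g * w.head, w.toList, w.chain⟩ w.chain
    (fun a _ b _ hmem => absurd hmem (hg _))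
  have hnil := ReducedWord.toList_eq_nil_of_mem_of_range φ w' (by
    convert! h using 1
    rw [h₁]
    simp [ReducedWord.prod, syllableProd, mul_assoc])
  rw [hnil] at h₂
  have hw : w.toList = [] := List.eq_nil_of_length_eq_zero (by simp at h₂; omega)
  exact ⟨w.head, by simp [ReducedWord.prod, hw]⟩

theorem t_zpow_mul_of_mul_inv_notMem_range (u : ℤˣ) {g : G} (hg : g ∉ toSubgroup A B u) :
    t ^ (u : ℤ) * of g * (t ^ (u : ℤ))⁻¹ ∉ (of : G →* HNNExtension G A B φ).range := by
  intro h
  have := ReducedWord.toList_eq_nil_of_mem_of_range φ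
    ⟨1, [(u, g), (-u, 1)], by simp [hg]⟩ (by
      convert! h using 1
      simp [ReducedWord.prod, mul_assoc])
  simp at this

theorem t_zpow_mul_of_mul_inv_mem_range (u : ℤˣ) {g : G} (hg : g ∈ toSubgroup A B u) :
    t ^ (u : ℤ) * of g * (t ^ (u : ℤ))⁻¹ ∈ (of : G →* HNNExtension G A B φ).range := by
  rcases Int.units_eq_one_or u with rfl | rfl
  · exact ⟨φ ⟨g, hg⟩, by simp [equiv_eq_conj]⟩
  · exact ⟨φ.symm ⟨g, hg⟩, by simp [equiv_symm_eq_conj]⟩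

theorem mem_neg_of_commute (u : ℤˣ) {g k : G} (hk : k ∉ toSubgroup A B u)
    (h : Commute (of g : HNNExtension G A B φ) (t ^ (u : ℤ) * of k * (t ^ (u : ℤ))⁻¹)) :
    g ∈ toSubgroup A B (-u) := by
  by_contra hg
  have := ReducedWord.toList_eq_nil_of_mem_of_range φ
    ⟨g, [(u, k), (-u, g⁻¹), (u, k⁻¹), (-u, 1)], by simp [hk, hg]⟩ (by
      convert! one_mem (of : G →* HNNExtension G A B φ).range using 1
      have h' := h.eq
      rw [← mul_inv_eq_iff_eq_mul, mul_inv_eq_one.symm] at h'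
      rw [← h']
      simp [ReducedWord.prod, mul_assoc])
  simp at this

/-- For an abelian base group and proper associated subgroups, the associated subgroups coincide
iff every base element with a centralizer larger than the base group commutes with all conjugates
of the base group. -/
theorem eq_iff_commute_conj {G : Type*} [CommGroup G] {A B : Subgroup G} (φ : A ≃* B)
    (hA : A ≠ ⊤) (hB : B ≠ ⊤) :
    A = B ↔ ∀ g : G, ∀ x ∉ (of : G →* HNNExtension G A B φ).range, Commute (of g) x →
      ∀ (y : G) (z : HNNExtension G A B φ), Commute (of g) (z * of y * z⁻¹) := by
  constructor
  · rintro rfl g x hx hgx y z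
    have hg : g ∈ A := by
      by_contra hg
      exact hx (mem_range_of_inv_mul_mul_mem_range hg hg inferInstance inferInstance
        ⟨g, by rw [mul_assoc, hgx.eq, inv_mul_cancel_left]⟩)
    have hconj : (A.map (of : G →* HNNExtension G A A φ)).Normal := by
      have key : ∀ z : HNNExtension G A A φ, (∀ a ∈ A, ∃ b ∈ A, of b = z * of a * z⁻¹) ∧
          (∀ a ∈ A, ∃ b ∈ A, of b = z⁻¹ * of a * z) := by
        intro z
        induction z using induction_on with
        | of g =>
          exact ⟨fun a ha => ⟨a, ha, by simp [← map_mul, ← map_inv]⟩,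
            fun a ha => ⟨a, ha, by simp [← map_mul, ← map_inv]⟩⟩
        | t =>
          exact ⟨fun a ha => ⟨φ ⟨a, ha⟩, (φ ⟨a, ha⟩).2, equiv_eq_conj _⟩,
            fun a ha => ⟨φ.symm ⟨a, ha⟩, (φ.symm ⟨a, ha⟩).2, equiv_symm_eq_conj _⟩⟩
        | mul x y hx hy =>
          constructor
          · intro a ha
            obtain ⟨b, hb, h⟩ := hy.1 a ha
            obtain ⟨c, hc, h'⟩ := hx.1 b hb
            exact ⟨c, hc, by rw [h', h]; group⟩
          · intro a ha
            obtain ⟨b, hb, h⟩ := hx.2 a ha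
            obtain ⟨c, hc, h'⟩ := hy.2 b hb
            exact ⟨c, hc, by rw [h', h]; group⟩
        | inv x hx => simpa using ⟨hx.2, hx.1⟩
      refine ⟨?_⟩
      rintro _ ⟨a, ha, rfl⟩ z
      exact (key z).1 a ha
    obtain ⟨b, -, hb⟩ := hconj.conj_mem _ (Subgroup.mem_map_of_mem of hg) z⁻¹
    have hgb : (of g : HNNExtension G A A φ) = z * of b * z⁻¹ := by
      rw [hb]; group
    rw [hgb, Commute.conj_iff]
    exact (Commute.all b y).map of
  · intro h
    have hne : ∀ u, ∃ k, k ∉ toSubgroup A B u := by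
      intro u
      by_contra! hu
      rcases Int.units_eq_one_or u with rfl | rfl
      · exact hA ((Subgroup.eq_top_iff' _).2 hu)
      · exact hB ((Subgroup.eq_top_iff' _).2 hu)
    have key : ∀ u, toSubgroup A B u ≤ toSubgroup A B (-u) := by
      intro u g hg
      obtain ⟨k, hk⟩ := hne (-u)
      obtain ⟨b, hb⟩ := t_zpow_mul_of_mul_inv_mem_range (φ := φ) u hg
      have hgb : (of g : HNNExtension G A B φ) =
          t ^ ((-u : ℤˣ) : ℤ) * of b * (t ^ ((-u : ℤˣ) : ℤ))⁻¹ := by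
        rw [hb]; simp [mul_assoc]
      have hcomm : Commute (of g : HNNExtension G A B φ)
          (t ^ ((-u : ℤˣ) : ℤ) * of k * (t ^ ((-u : ℤˣ) : ℤ))⁻¹) := by
        rw [hgb, Commute.conj_iff]
        exact (Commute.all b k).map of
      obtain ⟨k', hk'⟩ := hne u
      exact mem_neg_of_commute u hk' (h g _ (t_zpow_mul_of_mul_inv_notMem_range _ hk) hcomm k' _)
    exact le_antisymm (key 1) (by simpa using key (-1))

end HNNExtension

/-- For an abelian subgroup `H` with normal closure `K`, the elements of `H` whose centralizer is
not `H` lie in the center of `K` iff they commute with all conjugates of `H`. -/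
theorem forall_central_normalClosure_iff {Γ : Type*} [Group Γ] (H : Subgroup Γ)
    (hH : ∀ a ∈ H, ∀ b ∈ H, Commute a b) :
    (∀ g ∈ {g : Γ | g ∈ H ∧ Subgroup.centralizer {g} ≠ H},
      g ∈ Subgroup.normalClosure (H : Set Γ) ∧
        ∀ x ∈ Subgroup.normalClosure (H : Set Γ), Commute g x) ↔
    ∀ g ∈ H, ∀ x ∉ H, Commute g x → ∀ y ∈ H, ∀ z, Commute g (z * y * z⁻¹) := by
  constructor
  · intro h g hg x hx hgx y hy z
    refine (h g ⟨hg, fun heq => hx ?_⟩).2 _ (Subgroup.normalClosure_normal.conj_mem _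
      (Subgroup.subset_normalClosure hy) z)
    rw [← heq, Subgroup.mem_centralizer_singleton_iff]
    exact hgx.eq.symm
  · rintro h g ⟨hg, hne⟩
    refine ⟨Subgroup.subset_normalClosure hg, ?_⟩
    have hle : H ≤ Subgroup.centralizer {g} := fun a ha =>
      Subgroup.mem_centralizer_singleton_iff.2 (hH a ha g hg).eq
    obtain ⟨x, hx, hxH⟩ := SetLike.exists_of_lt (lt_of_le_of_ne hle hne.symm)
    have hgx : Commute g x := (Subgroup.mem_centralizer_singleton_iff.1 hx).symm
    have hK : Subgroup.normalClosure (H : Set Γ) ≤ Subgroup.centralizer {g} := by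
      refine (Subgroup.closure_le _).2 fun c hc => ?_
      obtain ⟨y, hy, hyc⟩ := Group.mem_conjugatesOfSet_iff.1 hc
      obtain ⟨z, rfl⟩ := isConj_iff.1 hyc
      exact Subgroup.mem_centralizer_singleton_iff.2 (h g hg x hxH hgx y hy z).eq.symm
    exact fun y hy => (Subgroup.mem_centralizer_singleton_iff.1 (hK hy)).symm

section LearyMinasyan

variable {n : ℕ} {A : Matrix (Fin n) (Fin n) ℚ} {L : AddSubgroup (Fin n → ℤ)}

theorem ZtoQ_injective (n : ℕ) : Function.Injective (ZtoQ n) := fun _ _ h =>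
  funext fun i => Int.cast_injective (α := ℚ) (congrFun h i)

theorem mem_ALsub_iff {w : Fin n → ℤ} :
    w ∈ ALsub A L ↔ ∃ v ∈ L, ZtoQ n w = A.mulVec (ZtoQ n v) := by
  simp [ALsub, QImage, eq_comm]

/-- Multiplication by `A` as an isomorphism from `L` to `AL`, in multiplicative notation. -/
theorem exists_mulEquiv_ALsub (hA : IsUnit A.det) (hLA : QImage A L ≤ (ZtoQ n).range) :
    ∃ φ : AddSubgroup.toSubgroup L ≃* AddSubgroup.toSubgroup (ALsub A L),
      ∀ v, ZtoQ n (φ v).1.toAdd = A.mulVec (ZtoQ n v.1.toAdd) := by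
  have hex : ∀ v : AddSubgroup.toSubgroup L,
      ∃ w : Fin n → ℤ, ZtoQ n w = A.mulVec (ZtoQ n v.1.toAdd) := fun v =>
    hLA ⟨_, ⟨_, v.2, rfl⟩, rfl⟩
  choose f hf using hex
  let F : AddSubgroup.toSubgroup L →* AddSubgroup.toSubgroup (ALsub A L) :=
    MonoidHom.mk' (fun v => ⟨Multiplicative.ofAdd (f v), mem_ALsub_iff.2 ⟨_, v.2, hf v⟩⟩) (by
      intro v w
      refine Subtype.ext (ZtoQ_injective n ?_)
      change ZtoQ n (f (v * w)) = ZtoQ n (f v + f w)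
      rw [map_add, hf, hf, hf, ← mulVec_add, ← map_add]
      rfl)
  refine ⟨MulEquiv.ofBijective F ⟨?_, ?_⟩, hf⟩
  · intro v w hvw
    have hfvw : f v = f w := congrArg (fun x => Multiplicative.toAdd x.1) hvw
    refine Subtype.ext (ZtoQ_injective n ?_)
    refine mulVec_injective_of_isUnit ((isUnit_iff_isUnit_det A).2 hA) ?_
    exact (hf v).symm.trans (hfvw ▸ hf w)
  · rintro ⟨w, hw⟩
    obtain ⟨v, hv, hvw⟩ := mem_ALsub_iff.1 hw
    exact ⟨⟨Multiplicative.ofAdd v, hv⟩,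
      Subtype.ext (ZtoQ_injective n ((hf _).trans hvw.symm))⟩

theorem map_xWord_eq {Γ G : Type*} [Group Γ] [CommGroup G] (F : FreeGroup (Fin n ⊕ Unit) →* Γ)
    (f : G →* Γ) (x : Fin n → G) (h : ∀ i, F (FreeGroup.of (Sum.inl i)) = f (x i))
    (v : Fin n → ℤ) : F (xWord n v) = f (∏ i, x i ^ v i) := by
  rw [xWord, map_list_prod, ← List.prod_ofFn, map_list_prod]
  simp [List.map_ofFn, Function.comp_def, h]

theorem Xg_commute (i j : Fin n) : Commute (Xg n A L i) (Xg n A L j) := by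
  have : PresentedGroup.mk (LMrels n A L) (FreeGroup.of (Sum.inl i) * FreeGroup.of (Sum.inl j) *
      (FreeGroup.of (Sum.inl i))⁻¹ * (FreeGroup.of (Sum.inl j))⁻¹) = 1 :=
    PresentedGroup.one_of_mem (Or.inl ⟨i, j, rfl⟩)
  simp only [map_mul, map_inv] at this
  rw [mul_inv_eq_one, mul_inv_eq_iff_eq_mul] at this
  exact this

theorem Hsub_commute : ∀ a ∈ Hsub n A L, ∀ b ∈ Hsub n A L, Commute a b := by
  have hc : ∀ x ∈ Set.range (Xg n A L), ∀ y ∈ Set.range (Xg n A L), x * y = y * x := by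
    rintro _ ⟨i, rfl⟩ _ ⟨j, rfl⟩
    exact Xg_commute i j
  have := Subgroup.isMulCommutative_closure hc
  intro a ha b hb
  exact congrArg Subtype.val
    (mul_comm' (⟨a, ha⟩ : Subgroup.closure (Set.range (Xg n A L))) ⟨b, hb⟩)

/-- The homomorphism `v ↦ x^v` from `ℤ^n` to `G(A,L)`. -/
theorem exists_hom_xWord (n : ℕ) (A : Matrix (Fin n) (Fin n) ℚ)
    (L : AddSubgroup (Fin n → ℤ)) :
    ∃ f : Multiplicative (Fin n → ℤ) →* LM n A L,
      (∀ v, f v = PresentedGroup.mk (LMrels n A L) (xWord n v.toAdd)) ∧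
      (∀ i, f (Multiplicative.ofAdd (Pi.single i 1)) = Xg n A L i) ∧
      ∀ v, f v ∈ Hsub n A L := by
  let : CommGroup (Hsub n A L) :=
    { (inferInstance : Group (Hsub n A L)) with
      mul_comm := fun a b => Subtype.ext (Hsub_commute a.1 a.2 b.1 b.2).eq }
  let x : Fin n → Hsub n A L := fun i => ⟨Xg n A L i, Subgroup.subset_closure ⟨i, rfl⟩⟩
  have hx : ∀ v, PresentedGroup.mk (LMrels n A L) (xWord n v) =
      (Hsub n A L).subtype (∏ i, x i ^ v i) := map_xWord_eq _ _ x fun i => rfl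
  refine ⟨MonoidHom.mk' (fun v => PresentedGroup.mk (LMrels n A L) (xWord n v.toAdd)) ?_,
    fun v => rfl, fun i => ?_, fun v => ?_⟩
  · intro v w
    rw [hx, hx, hx, ← map_mul, ← Finset.prod_mul_distrib]
    simp [_root_.zpow_add]
  · rw [MonoidHom.mk'_apply, hx, Finset.prod_eq_single i]
    · simp [x]
    · intro j _ hj
      simp [Pi.single_eq_of_ne hj]
    · simp
  · rw [MonoidHom.mk'_apply, hx]
    exact SetLike.coe_mem _

/-- The Leary–Minasyan group is an HNN extension of `ℤ^n`. -/
theorem exists_mulEquiv_HNNExtension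
    (φ : AddSubgroup.toSubgroup L ≃* AddSubgroup.toSubgroup (ALsub A L))
    (hφ : ∀ v, ZtoQ n (φ v).1.toAdd = A.mulVec (ZtoQ n v.1.toAdd)) :
    ∃ e : LM n A L ≃* HNNExtension (Multiplicative (Fin n → ℤ)) _ _ φ,
      (Hsub n A L).map e.toMonoidHom = HNNExtension.of.range := by
  obtain ⟨f, hf, hfx, hfmem⟩ := exists_hom_xWord n A L
  let x : Fin n → Multiplicative (Fin n → ℤ) := fun i => Multiplicative.ofAdd (Pi.single i 1)
  have hprod : ∀ v : Fin n → ℤ, ∏ i, x i ^ v i = Multiplicative.ofAdd v := by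
    intro v
    apply Multiplicative.toAdd.injective
    simp only [x, toAdd_prod, toAdd_zpow, toAdd_ofAdd]
    ext j
    simp [Finset.sum_apply, Pi.single_apply]
  let F₀ : Fin n ⊕ Unit → HNNExtension (Multiplicative (Fin n → ℤ)) _ _ φ :=
    Sum.elim (fun i => HNNExtension.of (x i)) fun _ => HNNExtension.t
  have hF₀ : ∀ v, FreeGroup.lift F₀ (xWord n v) = HNNExtension.of (Multiplicative.ofAdd v) := by
    intro v
    rw [map_xWord_eq _ HNNExtension.of x (fun i => by simp [F₀]), hprod]
  have hrel : ∀ r ∈ LMrels n A L, FreeGroup.lift F₀ r = 1 := by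
    rintro r (⟨i, j, rfl⟩ | ⟨v, hv, w, hw, rfl⟩)
    · simp only [map_mul, map_inv, FreeGroup.lift_apply_of, F₀, Sum.elim_inl]
      rw [← map_mul, mul_comm, map_mul]
      group
    · have hvw : (φ ⟨Multiplicative.ofAdd v, hv⟩).1 = Multiplicative.ofAdd w :=
        ZtoQ_injective n ((hφ _).trans hw.symm)
      simp only [map_mul, map_inv, FreeGroup.lift_apply_of, hF₀, ← hvw, F₀, Sum.elim_inr]
      rw [HNNExtension.equiv_eq_conj, mul_inv_cancel]
  let F := PresentedGroup.toGroup hrel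
  have hFf : ∀ v, F (f v) = HNNExtension.of v := fun v => by
    rw [hf]
    exact hF₀ v.toAdd
  have ht : ∀ a : AddSubgroup.toSubgroup L, Tg n A L * f a = f (φ a).1 * Tg n A L := by
    intro a
    have : PresentedGroup.mk (LMrels n A L) _ = 1 :=
      PresentedGroup.one_of_mem (Or.inr ⟨a.1.toAdd, a.2, (φ a).1.toAdd, hφ a, rfl⟩)
    simp only [map_mul, map_inv, ← hf] at this
    rw [mul_inv_eq_one, mul_inv_eq_iff_eq_mul] at this
    exact this
  let E := HNNExtension.lift f (Tg n A L) ht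
  have hEF : E.comp F = MonoidHom.id _ := by
    refine PresentedGroup.ext ?_
    rintro (i | i)
    · simp only [F, MonoidHom.comp_apply, PresentedGroup.toGroup.of, F₀, Sum.elim_inl, E,
        HNNExtension.lift_of, MonoidHom.id_apply]
      exact hfx i
    · simp only [F, MonoidHom.comp_apply, PresentedGroup.toGroup.of, F₀, Sum.elim_inr, E,
        HNNExtension.lift_t, MonoidHom.id_apply]
      rfl
  have hFE : F.comp E = MonoidHom.id _ := by
    refine HNNExtension.hom_ext (MonoidHom.ext fun v => ?_) ?_
    · simp [E, hFf]
    · simp only [MonoidHom.comp_apply, E, HNNExtension.lift_t, MonoidHom.id_apply]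
      exact PresentedGroup.toGroup.of hrel
  refine ⟨MonoidHom.toMulEquiv F E hEF hFE, ?_⟩
  change (Hsub n A L).map F = _
  apply le_antisymm
  · rw [Subgroup.map_le_iff_le_comap, Hsub, Subgroup.closure_le]
    rintro _ ⟨i, rfl⟩
    exact ⟨x i, (PresentedGroup.toGroup.of (x := Sum.inl i) hrel).symm⟩
  · rintro _ ⟨v, rfl⟩
    exact ⟨f v, hfmem v, hFf v⟩

end LearyMinasyan

/-- **Lemma.** Suppose `L ≠ ℤ^n` and `AL ≠ ℤ^n`, let `K` be the normal closure of the
base subgroup `H` in `G := G(A,L)` and let `H₁ = {g ∈ H ∣ C_G(g) ≠ H}`.  Then `AL = L`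
iff `H₁ ⊆ Z(K)`. -/
theorem LM_AL_eq_L_iff_H1_central
    (n : ℕ) (A : Matrix (Fin n) (Fin n) ℚ) (hA : IsUnit A.det)
    (L : AddSubgroup (Fin n → ℤ)) (hL : L.FiniteIndex)
    (hLA : QImage A L ≤ (ZtoQ n).range)
    (hneL : L ≠ ⊤) (hneAL : ALsub A L ≠ ⊤) :
    ALsub A L = L ↔
      ∀ g ∈ {g : LM n A L | g ∈ Hsub n A L ∧ Subgroup.centralizer {g} ≠ Hsub n A L},
        g ∈ Subgroup.normalClosure (Hsub n A L : Set (LM n A L)) ∧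
        ∀ x ∈ Subgroup.normalClosure (Hsub n A L : Set (LM n A L)), Commute g x := by
  obtain ⟨φ, hφ⟩ := exists_mulEquiv_ALsub hA hLA
  obtain ⟨e, he⟩ := exists_mulEquiv_HNNExtension φ hφ
  have hmem : ∀ z, z ∈ Hsub n A L ↔ e z ∈ (HNNExtension.of (φ := φ)).range := fun z => by
    rw [← he]
    exact (Subgroup.mem_map_iff_mem e.injective).symm
  have htop : ∀ {M : AddSubgroup (Fin n → ℤ)}, M ≠ ⊤ → AddSubgroup.toSubgroup M ≠ ⊤ :=
    fun hM h => hM (AddSubgroup.toSubgroup.injective (h.trans (map_top _).symm))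
  rw [forall_central_normalClosure_iff _ Hsub_commute, eq_comm,
    ← AddSubgroup.toSubgroup.injective.eq_iff,
    HNNExtension.eq_iff_commute_conj φ (htop hneL) (htop hneAL)]
  have hcomm : ∀ a b, Commute (e a) (e b) ↔ Commute a b := fun a b =>
    commute_map_iff e.injective
  constructor
  · intro h g hg x hx hgx y hy z
    obtain ⟨g', hg'⟩ := (hmem g).1 hg
    obtain ⟨y', hy'⟩ := (hmem y).1 hy
    have := h g' (e x) (fun h' => hx ((hmem x).2 h')) (by rwa [hg', hcomm]) y' (e z)
    rwa [hg', hy', ← map_mul, ← map_inv, ← map_mul, hcomm] at this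
  · intro h g x hx hgx y z
    obtain ⟨x, rfl⟩ := e.surjective x
    obtain ⟨z, rfl⟩ := e.surjective z
    obtain ⟨g', hg'⟩ := e.surjective (HNNExtension.of g)
    obtain ⟨y', hy'⟩ := e.surjective (HNNExtension.of y)
    rw [← hg', hcomm] at hgx
    rw [← hg', ← hy', ← map_mul, ← map_inv, ← map_mul, hcomm]
    exact h g' ((hmem _).2 ⟨g, hg'.symm⟩) x (fun h' => hx ((hmem x).1 h')) hgx y'
      ((hmem _).2 ⟨y, hy'.symm⟩) z
end
end

section
/- Let A, Ā ∈ GL_n(ℤ), and suppose that the semidirect products ℤ^n ⋊_A ℤ and ℤ^n ⋊_Ā ℤ are isomorphic and that Ā is not conjugate in GL_n(ℤ) to A or to A⁻¹. Then there exist a matrix C ∈ GL_{n-1}(ℤ) of finite order m₀, a vector u ∈ ℤ^{n-1}, and q ∈ ℤ with gcd(q, m₀) = 1 such that A and Ā are conjugate in GL_n(ℤ) to the block matrices [[1, 0ᵀ],[u, C]] and [[1, 0ᵀ],[u, C^q]], respectively. -/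
open Matrix

noncomputable section

/-- The automorphism of `ℤ^n` given by a matrix `A ∈ GL_n(ℤ)`. -/
def matAut {n : ℕ} (A : Matrix (Fin n) (Fin n) ℤ) (hA : IsUnit A.det) :
    (Fin n → ℤ) ≃+ (Fin n → ℤ) where
  toFun := A.mulVec
  invFun := A⁻¹.mulVec
  left_inv v := by
    rw [Matrix.mulVec_mulVec, Matrix.nonsing_inv_mul A hA, Matrix.one_mulVec]
  right_inv v := by
    rw [Matrix.mulVec_mulVec, Matrix.mul_nonsing_inv A hA, Matrix.one_mulVec]
  map_add' x y := by simp [Matrix.mulVec_add]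

/-- The semidirect product `ℤ^n ⋊_A ℤ`, where the generator of `ℤ` acts on `ℤ^n`
by `v ↦ Av`. -/
abbrev zSemidirect {n : ℕ} (A : Matrix (Fin n) (Fin n) ℤ) (hA : IsUnit A.det) :=
  SemidirectProduct (Multiplicative (Fin n → ℤ)) (Multiplicative ℤ)
    ((zpowersHom (MulAut (Multiplicative (Fin n → ℤ))))
      (AddEquiv.toMultiplicative (matAut A hA)))

open Multiplicative

/-- `G` is an extension of the infinite cyclic group generated by the image of `t` under `π`
by the image of the injective map `i`, and conjugation by `t` is `α`. -/
structure IsCyclicExt {V G : Type*} [AddCommGroup V] [Group G] (α : Module.End ℤ V)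
    (i : Multiplicative V →* G) (π : G →* Multiplicative ℤ) (t : G) : Prop where
  inj : Function.Injective i
  exact : ∀ g, π g = 1 ↔ ∃ x, i (ofAdd x) = g
  gen : π t = ofAdd 1
  conj : ∀ x, t * i (ofAdd x) * t⁻¹ = i (ofAdd (α x))

/-- The composition of `i` and `ψ`, as a linear form. -/
def linForm {V G : Type*} [AddCommGroup V] [Group G]
    (i : Multiplicative V →* G) (ψ : G →* Multiplicative ℤ) : V →ₗ[ℤ] ℤ :=
  (AddMonoidHom.toMultiplicative.symm (ψ.comp i)).toIntLinearMap

lemma linForm_apply {V G : Type*} [AddCommGroup V] [Group G]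
    (i : Multiplicative V →* G) (ψ : G →* Multiplicative ℤ) (x : V) :
    linForm i ψ x = toAdd (ψ (i (ofAdd x))) := rfl

namespace IsCyclicExt

variable {V W G : Type*} [AddCommGroup V] [AddCommGroup W] [Group G]
  {α : Module.End ℤ V} {i : Multiplicative V →* G} {π : G →* Multiplicative ℤ} {t : G}
  {β : Module.End ℤ W} {j : Multiplicative W →* G} {ψ : G →* Multiplicative ℤ} {s : G}

lemma eq_of_map_eq (h : IsCyclicExt α i π t) {x y : V} (hxy : i (ofAdd x) = i (ofAdd y)) :
    x = y := ofAdd.injective (h.inj hxy)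

lemma exists_eq_mul_zpow (h : IsCyclicExt α i π t) (g : G) :
    ∃ v, g = i (ofAdd v) * t ^ (toAdd (π g)) := by
  have h1 : π (g * (t ^ (toAdd (π g)))⁻¹) = 1 := by
    rw [map_mul, map_inv, map_zpow, h.gen, ← ofAdd_zsmul]
    simp
  obtain ⟨v, hv⟩ := (h.exact _).1 h1
  exact ⟨v, by rw [hv]; group⟩

lemma map_ofAdd_eq_one (h : IsCyclicExt α i π t) (x : V) : π (i (ofAdd x)) = 1 :=
  (h.exact _).2 ⟨x, rfl⟩

/-- The conjugation action of the whole group on the kernel of `π`. -/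
lemma exists_action (h : IsCyclicExt α i π t) :
    ∃ ρ : G →* Module.End ℤ V, ∀ g x, i (ofAdd (ρ g x)) = g * i (ofAdd x) * g⁻¹ := by
  have key : ∀ g x, ∃ y, i (ofAdd y) = g * i (ofAdd x) * g⁻¹ := fun g x => by
    rw [← h.exact]
    simp [h.map_ofAdd_eq_one]
  choose r hr using key
  refine ⟨{ toFun := fun g => (AddMonoidHom.mk' (r g) fun x y => ?_).toIntLinearMap
            map_one' := ?_
            map_mul' := ?_ }, fun g x => hr g x⟩
  · apply h.eq_of_map_eq
    simp only [ofAdd_add, map_mul, hr]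
    group
  · ext x
    apply h.eq_of_map_eq
    simp [hr]
  · intro g g'
    ext x
    apply h.eq_of_map_eq
    simp [hr, mul_assoc]

lemma exists_linForm_add (h : IsCyclicExt α i π t) (ψ : G →* Multiplicative ℤ) (g : G) :
    ∃ v, g = i (ofAdd v) * t ^ (toAdd (π g)) ∧
      toAdd (ψ g) = linForm i ψ v + toAdd (π g) * toAdd (ψ t) := by
  obtain ⟨v, hv⟩ := h.exists_eq_mul_zpow g
  refine ⟨v, hv, ?_⟩
  conv_lhs => rw [hv]
  simp [linForm_apply]

/-- The two subgroups `ker π` and `ker ψ` have the same intersection, seen from either side. -/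
lemma exists_kerEquiv (h₁ : IsCyclicExt α i π t) (h₂ : IsCyclicExt β j ψ s) :
    ∃ κ : (linForm i ψ).ker ≃ₗ[ℤ] (linForm j π).ker,
      ∀ x, j (ofAdd (κ x : W)) = i (ofAdd (x : V)) := by
  have key : ∀ x : (linForm i ψ).ker, ∃ y : (linForm j π).ker,
      j (ofAdd (y : W)) = i (ofAdd (x : V)) := by
    rintro ⟨x, hx⟩
    obtain ⟨y, hy⟩ := (h₂.exact (i (ofAdd x))).1 hx
    exact ⟨⟨y, by rw [LinearMap.mem_ker, linForm_apply, hy, h₁.map_ofAdd_eq_one]; rfl⟩, hy⟩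
  choose r hr using key
  refine ⟨LinearEquiv.ofBijective (AddMonoidHom.mk' r fun x y => ?_).toIntLinearMap ⟨?_, ?_⟩, hr⟩
  · apply Subtype.ext
    apply h₂.eq_of_map_eq
    simp [hr]
  · intro x y hxy
    apply Subtype.ext
    apply h₁.eq_of_map_eq
    rw [← hr, ← hr]
    exact congrArg (fun z : (linForm j π).ker => j (ofAdd (z : W))) hxy
  · rintro ⟨y, hy⟩
    obtain ⟨x, hx⟩ := (h₁.exact (j (ofAdd y))).1 hy
    refine ⟨⟨x, by rw [LinearMap.mem_ker, linForm_apply, hx, h₂.map_ofAdd_eq_one]; rfl⟩, ?_⟩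
    apply Subtype.ext
    apply h₂.eq_of_map_eq
    exact (hr _).trans hx

lemma linForm_eq_zero (h₁ : IsCyclicExt α i π t) (h₂ : IsCyclicExt β j ψ s)
    (h0 : linForm i ψ = 0) : linForm j π = 0 := by
  obtain ⟨v, -, hv⟩ := h₁.exists_linForm_add ψ s
  ext w
  obtain ⟨x, -, hx⟩ := h₁.exists_linForm_add ψ (j (ofAdd w))
  rw [h₂.gen, h0] at hv
  rw [h₂.map_ofAdd_eq_one, h0] at hx
  simp only [toAdd_one, toAdd_ofAdd, LinearMap.zero_apply, zero_add] at hv hx ⊢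
  rw [linForm_apply]
  rcases mul_eq_zero.1 hx.symm with h | h
  · exact h
  · rw [h] at hv; simp at hv

lemma linForm_action (ψ : G →* Multiplicative ℤ)
    {ρ : G →* Module.End ℤ V} (hρ : ∀ g x, i (ofAdd (ρ g x)) = g * i (ofAdd x) * g⁻¹)
    (g : G) (x : V) : linForm i ψ (ρ g x) = linForm i ψ x := by
  simp [linForm_apply, hρ]

lemma isCoprime_of_dvd (h₁ : IsCyclicExt α i π t) (h₂ : IsCyclicExt β j ψ s) {k : ℤ}
    (hk : ∀ y, k ∣ linForm j π y) : IsCoprime k (toAdd (π s)) := by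
  obtain ⟨v, -, hv⟩ := h₂.exists_linForm_add π t
  obtain ⟨c, hc⟩ := hk v
  rw [h₁.gen, toAdd_ofAdd, hc] at hv
  exact ⟨c, toAdd (ψ t), by rw [hv]; ring⟩

lemma dvd_linForm (h₁ : IsCyclicExt α i π t) (h₂ : IsCyclicExt β j ψ s) {k : ℤ}
    (hk : ∀ y, k ∣ linForm j π y) (v : V) : k ∣ linForm i ψ v := by
  obtain ⟨w, -, hw⟩ := h₂.exists_linForm_add π (i (ofAdd v))
  rw [h₁.map_ofAdd_eq_one, toAdd_one, ← linForm_apply i ψ] at hw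
  refine (h₁.isCoprime_of_dvd h₂ hk).dvd_of_dvd_mul_right ?_
  have : linForm i ψ v * toAdd (π s) = -linForm j π w := by linarith
  rw [this]
  exact (hk w).neg_right

end IsCyclicExt

lemma coe_eq_sum_repr {V : Type*} [AddCommGroup V] {k : ℕ} {L : Submodule ℤ V}
    (b : Module.Basis (Fin k) ℤ L) (x : L) : (x : V) = ∑ a, b.repr x a • (b a : V) := by
  have := congrArg L.subtype (b.sum_repr x).symm
  rw [map_sum] at this
  simpa only [map_smul, Submodule.subtype_apply] using this

section Action

variable {V G : Type*} [AddCommGroup V] [Group G] (ρ : G →* Module.End ℤ V) {L : Submodule ℤ V}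

lemma action_zpow_add_one (g : G) (m : ℤ) (x : V) : ρ (g ^ (m + 1)) x = ρ g (ρ (g ^ m) x) := by
  rw [add_comm m, _root_.zpow_add, zpow_one, map_mul, Module.End.mul_apply]

lemma action_zpow_sub_mem (hL : ∀ g, ∀ x ∈ L, ρ g x ∈ L) (g : G) (m : ℤ) {x : V} (hx : x ∈ L) :
    ρ (g ^ m) x - x ∈ L.map (ρ g - 1) := by
  have step : ∀ m : ℤ, (ρ (g ^ (m + 1)) x - x) - (ρ (g ^ m) x - x) ∈ L.map (ρ g - 1) := by
    intro m
    refine ⟨ρ (g ^ m) x, hL _ _ hx, ?_⟩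
    simp [action_zpow_add_one]
  induction m using Int.induction_on with
  | zero => simp
  | succ m ih => simpa using add_mem (step m) ih
  | pred m ih =>
    have := sub_mem ih (step (-m - 1))
    simpa using this

lemma action_zpow_sub_sub_mem (hL : ∀ g, ∀ x ∈ L, ρ g x ∈ L) (g : G) (m : ℤ) {e : V}
    (he : ρ g e - e ∈ L) : ρ (g ^ m) e - e - m • (ρ g e - e) ∈ L.map (ρ g - 1) := by
  have step : ∀ m : ℤ, (ρ (g ^ (m + 1)) e - e - (m + 1) • (ρ g e - e)) -
      (ρ (g ^ m) e - e - m • (ρ g e - e)) ∈ L.map (ρ g - 1) := by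
    intro m
    have h1 : ρ (g ^ (m + 1)) e = ρ (g ^ m) (ρ g e) := by
      rw [_root_.zpow_add, zpow_one, map_mul, Module.End.mul_apply]
    convert action_zpow_sub_mem ρ hL g m he using 1
    rw [h1, map_sub, add_smul, one_smul]
    abel
  induction m using Int.induction_on with
  | zero => simp
  | succ m ih => simpa using add_mem (step m) ih
  | pred m ih =>
    have := sub_mem ih (step (-m - 1))
    simpa using this

lemma action_zpow_sub_smul_mem (hL : ∀ g, ∀ x ∈ L, ρ g x ∈ L) (g : G) (m : ℤ) {e x : V} (c : ℤ)
    (he : ρ g e - e ∈ L) (hx : x - c • e ∈ L) :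
    ρ (g ^ m) x - x - (m * c) • (ρ g e - e) ∈ L.map (ρ g - 1) := by
  have h1 := (L.map (ρ g - 1)).smul_mem c (action_zpow_sub_sub_mem ρ hL g m he)
  convert add_mem h1 (action_zpow_sub_mem ρ hL g m hx) using 1
  rw [map_sub, map_zsmul, mul_comm m c, mul_smul]
  simp only [smul_sub]
  abel

end Action

namespace IsCyclicExt

variable {V W G : Type*} [AddCommGroup V] [AddCommGroup W] [Group G]
  {α : Module.End ℤ V} {i : Multiplicative V →* G} {π : G →* Multiplicative ℤ} {t : G}
  {β : Module.End ℤ W} {j : Multiplicative W →* G} {ψ : G →* Multiplicative ℤ} {s : G}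

lemma action_eq_zpow (h : IsCyclicExt α i π t)
    {ρ : G →* Module.End ℤ V} (hρ : ∀ g x, i (ofAdd (ρ g x)) = g * i (ofAdd x) * g⁻¹)
    (g : G) : ρ g = ρ (t ^ toAdd (π g)) := by
  obtain ⟨v, hv⟩ := h.exists_eq_mul_zpow g
  ext x
  apply h.eq_of_map_eq
  conv_lhs => rw [hv, map_mul, Module.End.mul_apply, hρ, ← map_mul, mul_comm, map_mul,
    mul_inv_cancel_right]

lemma action_gen (h : IsCyclicExt α i π t)
    {ρ : G →* Module.End ℤ V} (hρ : ∀ g x, i (ofAdd (ρ g x)) = g * i (ofAdd x) * g⁻¹) :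
    ρ t = α := by
  ext x
  exact h.eq_of_map_eq (by rw [hρ, h.conj])

lemma kerEquiv_action (h₂ : IsCyclicExt β j ψ s)
    {κ : (linForm i ψ).ker ≃ₗ[ℤ] (linForm j π).ker}
    (hκ : ∀ x, j (ofAdd (κ x : W)) = i (ofAdd (x : V)))
    {ρ : G →* Module.End ℤ V} (hρ : ∀ g x, i (ofAdd (ρ g x)) = g * i (ofAdd x) * g⁻¹)
    {x y : (linForm i ψ).ker} (hy : (y : V) = ρ s x) :
    β (κ x) = κ y := by
  apply h₂.eq_of_map_eq
  rw [← h₂.conj, hκ, hκ, hy, hρ]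

/-- The commutator of a lift of a generator of `ker ψ / (ker π ⊓ ker ψ)` with `s`, computed in
`ker π`. -/
lemma map_sub_eq (h₂ : IsCyclicExt β j ψ s)
    {ρ : G →* Module.End ℤ V} (hρ : ∀ g x, i (ofAdd (ρ g x)) = g * i (ofAdd x) * g⁻¹)
    {v w : V} {q k : ℤ} {f : W}
    (hs : s = i (ofAdd v) * t ^ q) (hf : j (ofAdd f) = i (ofAdd w) * t ^ k) :
    j (ofAdd (β f - f)) = i (ofAdd ((ρ (t ^ q) w - w) - (ρ (t ^ k) v - v))) := by
  have : (ρ (t ^ q) w - w) - (ρ (t ^ k) v - v) = v + ρ (t ^ q) w - ρ (t ^ k) v - w := by abel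
  rw [this]
  simp only [ofAdd_sub, ofAdd_add, map_mul, hρ, ← h₂.conj, hf, hs, div_eq_mul_inv,
    _root_.mul_inv_rev, map_inv, inv_inv]
  group

/-- Given lifts `e`, `f` of generators of `ker π` and `ker ψ` modulo their intersection, `f` can be
modified so that `α` and `β` translate the lifts by the same element of the intersection. -/
lemma exists_adapted (h₁ : IsCyclicExt α i π t) (h₂ : IsCyclicExt β j ψ s)
    {κ : (linForm i ψ).ker ≃ₗ[ℤ] (linForm j π).ker}
    (hκ : ∀ x, j (ofAdd (κ x : W)) = i (ofAdd (x : V))) {e : V} {f : W}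
    (he0 : linForm i ψ e ≠ 0) (he : ∀ v, linForm i ψ e ∣ linForm i ψ v)
    (hf : ∀ w, linForm j π f ∣ linForm j π w) :
    ∃ f', (linForm j π f' = linForm j π f ∨ linForm j π f' = -linForm j π f) ∧
      ∃ x : (linForm i ψ).ker, α e = e + x ∧ β f' = f' + κ x := by
  obtain ⟨ρ, hρ⟩ := h₁.exists_action
  have hL : ∀ g, ∀ x ∈ (linForm i ψ).ker, ρ g x ∈ (linForm i ψ).ker := fun g x hx => by
    rw [LinearMap.mem_ker, linForm_action ψ hρ]; exact hx
  have hLs : ∀ g x, ρ g x - x ∈ (linForm i ψ).ker := fun g x => by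
    rw [LinearMap.mem_ker, map_sub, linForm_action ψ hρ, sub_self]
  have hβ : ∀ x : (linForm i ψ).ker, β (κ x) = κ ⟨ρ s x, hL s x x.2⟩ := fun x =>
    h₂.kerEquiv_action hκ hρ rfl
  obtain ⟨v, hsv, hv⟩ := h₁.exists_linForm_add ψ s
  obtain ⟨w, hfw, hw⟩ := h₁.exists_linForm_add ψ (j (ofAdd f))
  rw [h₂.gen, toAdd_ofAdd] at hv
  rw [h₂.map_ofAdd_eq_one, toAdd_one] at hw
  rw [← linForm_apply j π] at hfw hw
  have hcomm := h₂.map_sub_eq hρ hsv hfw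
  set d := linForm i ψ e
  set k := linForm j π f
  set q := toAdd (π s)
  set a := toAdd (ψ t)
  obtain ⟨v₁, hv₁⟩ := he v
  obtain ⟨w₁, hw₁⟩ := he w
  have hvL : v - v₁ • e ∈ (linForm i ψ).ker := by
    rw [LinearMap.mem_ker, map_sub, map_zsmul, hv₁]; simp [d]; ring
  have hwL : w - w₁ • e ∈ (linForm i ψ).ker := by
    rw [LinearMap.mem_ker, map_sub, map_zsmul, hw₁]; simp [d]; ring
  rw [hv₁] at hv
  rw [hw₁] at hw
  obtain ⟨D, hD⟩ : ∃ D, D = q * w₁ - k * v₁ := ⟨_, rfl⟩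
  have hDd : d * D = -k := by rw [hD]; linear_combination k * hv - q * hw
  have hkd : k ∣ d := h₁.dvd_linForm h₂ hf e
  have hdk : d ∣ k := h₂.dvd_linForm h₁ he f
  have hD1 : D * D = 1 := by
    rcases Int.natAbs_eq_natAbs_iff.1 (Int.natAbs_eq_of_dvd_dvd hkd hdk) with h | h
    · have : D = -1 := mul_left_cancel₀ he0 (by rw [hDd, h]; ring)
      rw [this]; rfl
    · have : D = 1 := mul_left_cancel₀ he0 (by rw [hDd, h]; ring)
      rw [this]; rfl
  have hz : (ρ (t ^ q) w - w) - (ρ (t ^ k) v - v) - D • (ρ t e - e) ∈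
      (linForm i ψ).ker.map (ρ t - 1) := by
    convert sub_mem (action_zpow_sub_smul_mem ρ hL t q w₁ (hLs t e) hwL)
      (action_zpow_sub_smul_mem ρ hL t k v₁ (hLs t e) hvL) using 1
    rw [hD, sub_smul]
    abel
  have hst : ∀ x ∈ (linForm i ψ).ker, ρ (s ^ a) x = ρ t x := by
    intro x hx
    obtain ⟨c, hc, -⟩ := h₂.exists_linForm_add π t
    apply h₁.eq_of_map_eq
    have h2 := hκ ⟨_, hL (s ^ a) x hx⟩
    rw [hρ t, hc]
    have h3 : j (ofAdd (κ ⟨_, hL (s ^ a) x hx⟩ : W)) = i (ofAdd (ρ (s ^ a) x)) := h2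
    have h4 : j (ofAdd c) * i (ofAdd (ρ (s ^ a) x)) * (j (ofAdd c))⁻¹ =
        i (ofAdd (ρ (s ^ a) x)) := by
      rw [← h3, ← map_mul, mul_comm, map_mul, mul_inv_cancel_right]
    rw [← h4, hρ]
    simp only [a]
    group
  obtain ⟨y, hyL, hy⟩ : (ρ (t ^ q) w - w) - (ρ (t ^ k) v - v) - D • (ρ t e - e) ∈
      (linForm i ψ).ker.map (ρ s - 1) := by
    obtain ⟨x, hx, hx'⟩ := hz
    rw [← hx']
    have := action_zpow_sub_mem ρ hL s a hx
    rwa [hst x hx] at this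
  have hzu : β f - f = κ (D • ⟨ρ t e - e, hLs t e⟩ + (⟨ρ s y, hL s y hyL⟩ - ⟨y, hyL⟩)) := by
    apply h₂.eq_of_map_eq
    rw [hcomm, hκ]
    congr 2
    have h6 : ρ s y - y = _ := hy
    simp only [Submodule.coe_add, Submodule.coe_sub, Submodule.coe_smul, h6]
    abel
  have hκy : linForm j π (κ ⟨y, hyL⟩) = 0 := (κ ⟨y, hyL⟩).2
  refine ⟨D • (f - κ ⟨y, hyL⟩), ?_, ⟨ρ t e - e, hLs t e⟩, ?_, ?_⟩
  · rw [map_zsmul, map_sub, hκy, sub_zero]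
    rcases Int.eq_one_or_neg_one_of_mul_eq_one hD1 with h | h <;> simp [h, k]
  · rw [← h₁.action_gen hρ]; simp
  · have h5 : β f = f + κ (D • ⟨ρ t e - e, hLs t e⟩ + (⟨ρ s y, hL s y hyL⟩ - ⟨y, hyL⟩)) := by
      rw [← hzu]; abel
    rw [map_zsmul, map_sub, hβ, h5]
    simp only [map_add, map_sub, map_zsmul, Submodule.coe_add, Submodule.coe_sub,
      Submodule.coe_smul, smul_add, smul_sub, smul_smul, hD1, one_smul]
    abel

/-- If the two kernels coincide, the two automorphisms are conjugate up to inversion. -/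
lemma exists_conj_of_linForm_eq_zero (h₁ : IsCyclicExt α i π t) (h₂ : IsCyclicExt β j ψ s)
    (h0 : linForm i ψ = 0) :
    ∃ κ : V ≃ₗ[ℤ] W, (∀ x, β (κ x) = κ (α x)) ∨ (∀ x, β (κ (α x)) = κ x) := by
  obtain ⟨κ, hκ⟩ := h₁.exists_kerEquiv h₂
  obtain ⟨ρ, hρ⟩ := h₁.exists_action
  have hV : (linForm i ψ).ker = ⊤ := by rw [h0, LinearMap.ker_zero]
  have hW : (linForm j π).ker = ⊤ := by rw [h₁.linForm_eq_zero h₂ h0, LinearMap.ker_zero]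
  have hV' : ∀ x, x ∈ (linForm i ψ).ker := fun x => hV ▸ Submodule.mem_top
  have hρs := h₁.action_eq_zpow hρ s
  obtain ⟨v, -, hv⟩ := h₁.exists_linForm_add ψ s
  rw [h₂.gen, h0, toAdd_ofAdd, LinearMap.zero_apply, zero_add] at hv
  refine ⟨(LinearEquiv.ofTop _ hV).symm ≪≫ₗ κ ≪≫ₗ LinearEquiv.ofTop _ hW, ?_⟩
  rcases Int.eq_one_or_neg_one_of_mul_eq_one hv.symm with hq | hq
  · left
    intro x
    refine h₂.kerEquiv_action (x := ⟨x, hV' x⟩) (y := ⟨α x, hV' _⟩) hκ hρ ?_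
    rw [hρs, hq, zpow_one, h₁.action_gen hρ]
  · right
    intro x
    refine h₂.kerEquiv_action (x := ⟨α x, hV' _⟩) (y := ⟨x, hV' x⟩) hκ hρ ?_
    rw [hρs, hq, ← h₁.action_gen hρ, ← Module.End.mul_apply, ← map_mul]
    simp

/-- The conjugation action of the whole group on the intersection of the two kernels, in terms
of matrices. -/
lemma exists_matrix_action {k : ℕ} (b : Module.Basis (Fin k) ℤ (linForm i ψ).ker)
    {ρ : G →* Module.End ℤ V} (hρ : ∀ g x, i (ofAdd (ρ g x)) = g * i (ofAdd x) * g⁻¹) :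
    ∃ R : G →* Matrix (Fin k) (Fin k) ℤ,
      (∀ g c, ρ g (b c) = ∑ a, R g a c • (b a : V)) ∧
      ∀ g, (∀ x ∈ (linForm i ψ).ker, ρ g x = x) → R g = 1 := by
  have hL : ∀ g, ∀ x ∈ (linForm i ψ).ker, ρ g x ∈ (linForm i ψ).ker := fun g x hx => by
    rw [LinearMap.mem_ker, linForm_action ψ hρ]; exact hx
  let r : G →* Module.End ℤ (linForm i ψ).ker :=
    { toFun := fun g => (ρ g).restrict (hL g)
      map_one' := by ext x; simp
      map_mul' := fun g g' => by ext x; simp }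
  have hr : ∀ g x, (r g x : V) = ρ g x := fun g x => rfl
  refine ⟨(LinearMap.toMatrixAlgEquiv b : _ →* _).comp r, fun g c => ?_, fun g hg => ?_⟩
  · rw [← hr, coe_eq_sum_repr b]
    simp [LinearMap.toMatrixAlgEquiv_apply]
  · have : r g = 1 := by
      ext x
      exact hg x x.2
    simp [this]

end IsCyclicExt

/-- A matrix preserving the kernel of a linear form and acting trivially on the quotient has
block form in an adapted basis. -/
lemma exists_conj_blockOne {n k : ℕ} (A : Matrix (Fin n) (Fin n) ℤ)
    (l : (Fin n → ℤ) →ₗ[ℤ] ℤ) (b : Module.Basis (Fin k) ℤ l.ker) (e : Fin n → ℤ)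
    (he : l e ≠ 0) (hdvd : ∀ v, l e ∣ l v) (u : Fin k → ℤ) (C : Matrix (Fin k) (Fin k) ℤ)
    (hu : A *ᵥ e = e + ∑ a, u a • (b a : Fin n → ℤ))
    (hC : ∀ c, A *ᵥ (b c : Fin n → ℤ) = ∑ a, C a c • (b a : Fin n → ℤ)) :
    ∃ hk : k + 1 = n, ∃ B : Matrix (Fin n) (Fin n) ℤ, IsUnit B.det ∧
      A = B * Matrix.reindex (finCongr hk) (finCongr hk) (blockOne u C) * B⁻¹ := by
  let b' : Module.Basis (Fin (k + 1)) ℤ (Fin n → ℤ) := Module.Basis.mkFinCons e b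
    (fun c x hx h => by
      have := congrArg l h
      rw [map_add, LinearMap.mem_ker.1 hx] at this
      rw [map_smul, add_zero, map_zero, smul_eq_mul] at this
      exact (mul_eq_zero.1 this).resolve_right he)
    (fun z => by
      obtain ⟨c, hc⟩ := hdvd z
      refine ⟨-c, ?_⟩
      rw [LinearMap.mem_ker, map_add, map_smul, hc]
      simp; ring)
  have hb' : ⇑b' = Fin.cons e (fun a => (b a : Fin n → ℤ)) := by
    simp [b', Module.Basis.coe_mkFinCons]
    rfl
  have hk : k + 1 = n := by
    have h1 := Module.finrank_eq_card_basis b'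
    simpa using h1.symm
  subst hk
  refine ⟨rfl, (Pi.basisFun ℤ (Fin (k + 1))).toMatrix b', ?_, ?_⟩
  · rw [← Module.Basis.det_apply]
    exact Module.Basis.isUnit_det _ _
  · set B := (Pi.basisFun ℤ (Fin (k + 1))).toMatrix b' with hB
    have hBu : IsUnit B.det := by
      rw [← Module.Basis.det_apply]
      exact Module.Basis.isUnit_det _ _
    have hcol : ∀ x y, B x y = b' y x := fun x y => by simp [hB, Module.Basis.toMatrix_apply]
    have hmul : A * B = B * blockOne u C := by
      ext x y
      have h1 : (A * B) x y = (A *ᵥ b' y) x := by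
        simp [Matrix.mul_apply, Matrix.mulVec, dotProduct, hcol]
      rw [h1, Matrix.mul_apply, Fin.sum_univ_succ]
      simp only [hcol, hb']
      refine Fin.cases ?_ (fun y => ?_) y
      · simp [hu, blockOne, mul_comm]
      · simp [hC, blockOne, mul_comm]
    have : Matrix.reindex (finCongr rfl) (finCongr rfl) (blockOne u C) = blockOne u C := by
      ext; simp
    rw [this, ← hmul, Matrix.mul_assoc, Matrix.mul_nonsing_inv _ hBu, Matrix.mul_one]

lemma MonoidHom.map_zpow_matrix {G : Type*} [Group G] {k : ℕ}
    (R : G →* Matrix (Fin k) (Fin k) ℤ) (g : G) (m : ℤ) : R (g ^ m) = R g ^ m := by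
  rw [← R.coe_toHomUnits, map_zpow, Matrix.coe_units_zpow, R.coe_toHomUnits]

lemma exists_generator {V : Type*} [AddCommGroup V] (l : V →ₗ[ℤ] ℤ) :
    ∃ e, ∀ v, l e ∣ l v := by
  obtain ⟨d, hd⟩ := (IsPrincipalIdealRing.principal (LinearMap.range l)).principal
  have hmem : d ∈ LinearMap.range l := by
    rw [hd]; exact Submodule.mem_span_singleton_self d
  obtain ⟨e, rfl⟩ := hmem
  refine ⟨e, fun v => ?_⟩
  have hv : l v ∈ LinearMap.range l := ⟨v, rfl⟩
  rw [hd, Submodule.mem_span_singleton] at hv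
  obtain ⟨c, hc⟩ := hv
  exact ⟨c, by rw [← hc, smul_eq_mul, mul_comm]⟩

open IsCyclicExt in
theorem exists_blockOne_of_isCyclicExt {n : ℕ} {G : Type*} [Group G]
    {A Ab : Matrix (Fin n) (Fin n) ℤ}
    {i j : Multiplicative (Fin n → ℤ) →* G} {π ψ : G →* Multiplicative ℤ} {t s : G}
    (h₁ : IsCyclicExt (Matrix.toLin' A) i π t) (h₂ : IsCyclicExt (Matrix.toLin' Ab) j ψ s)
    (h0 : linForm i ψ ≠ 0) :
    ∃ k : ℕ, ∃ hk : k + 1 = n, ∃ C : Matrix (Fin k) (Fin k) ℤ, ∃ m₀ : ℕ,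
      0 < m₀ ∧ orderOf C = m₀ ∧
      ∃ u : Fin k → ℤ, ∃ q : ℤ, Int.gcd q m₀ = 1 ∧
        (∃ B : Matrix (Fin n) (Fin n) ℤ, IsUnit B.det ∧
          A = B * Matrix.reindex (finCongr hk) (finCongr hk) (blockOne u C) * B⁻¹) ∧
        (∃ B : Matrix (Fin n) (Fin n) ℤ, IsUnit B.det ∧
          Ab = B * Matrix.reindex (finCongr hk) (finCongr hk) (blockOne u (C ^ q)) * B⁻¹) := by
  obtain ⟨ρ, hρ⟩ := h₁.exists_action
  obtain ⟨κ, hκ⟩ := h₁.exists_kerEquiv h₂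
  obtain ⟨e, he⟩ := exists_generator (linForm i ψ)
  obtain ⟨f₀, hf₀⟩ := exists_generator (linForm j π)
  have ne_zero : ∀ {l : (Fin n → ℤ) →ₗ[ℤ] ℤ} {x}, l ≠ 0 → (∀ v, l x ∣ l v) → l x ≠ 0 := by
    intro l x hl hx h
    refine hl (LinearMap.ext fun v => ?_)
    simpa [h] using hx v
  have he0 := ne_zero h0 he
  have hf₀0 := ne_zero (fun h => h0 (h₂.linForm_eq_zero h₁ h)) hf₀
  obtain ⟨f, hf, x, hx, hfx⟩ := h₁.exists_adapted h₂ hκ he0 he hf₀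
  have hf0 : linForm j π f ≠ 0 := by
    rcases hf with h | h <;> simpa [h] using hf₀0
  have hfd : ∀ w, linForm j π f ∣ linForm j π w := by
    rcases hf with h | h <;> simpa [h] using hf₀
  obtain ⟨k, b⟩ := Submodule.basisOfPid (Pi.basisFun ℤ (Fin n)) (linForm i ψ).ker
  obtain ⟨R, hR, hR1⟩ := exists_matrix_action b hρ
  have hRs : R s = R t ^ toAdd (π s) := by
    have hs : R (s * (t ^ toAdd (π s))⁻¹) = 1 := by
      refine hR1 _ fun x _ => ?_
      rw [h₁.action_eq_zpow hρ]
      simp [h₁.gen]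
    rw [← R.map_zpow_matrix, ← one_mul (R (t ^ _)), ← hs, ← map_mul, inv_mul_cancel_right]
  have hRk : R t ^ linForm j π f = 1 := by
    rw [← R.map_zpow_matrix]
    refine hR1 _ fun x hx => ?_
    have h3 : ρ (t ^ linForm j π f) = ρ (j (ofAdd f)) := (h₁.action_eq_zpow hρ _).symm
    rw [h3]
    apply h₁.eq_of_map_eq
    rw [hρ, ← hκ ⟨x, hx⟩, ← map_mul, mul_comm, map_mul, mul_inv_cancel_right]
  have hdvd : (orderOf (R t) : ℤ) ∣ linForm j π f := by
    rw [← R.coe_toHomUnits, orderOf_units, orderOf_dvd_iff_zpow_eq_one]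
    apply Units.ext
    rw [Matrix.coe_units_zpow, R.coe_toHomUnits, hRk, Units.val_one]
  have hpos : 0 < orderOf (R t) := by
    rcases Nat.eq_zero_or_pos (orderOf (R t)) with h | h
    · rw [h, Nat.cast_zero, zero_dvd_iff] at hdvd
      exact absurd hdvd hf0
    · exact h
  have hcop : Int.gcd (toAdd (π s)) (orderOf (R t)) = 1 := by
    rw [← Int.isCoprime_iff_gcd_eq_one]
    exact ((h₁.isCoprime_of_dvd h₂ hfd).of_isCoprime_of_dvd_left hdvd).symm
  have hAe : A *ᵥ e = e + ∑ a, b.repr x a • (b a : Fin n → ℤ) := by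
    rw [← coe_eq_sum_repr, ← hx, Matrix.toLin'_apply]
  have hAb : ∀ c, A *ᵥ (b c : Fin n → ℤ) = ∑ a, R t a c • (b a : Fin n → ℤ) := fun c => by
    rw [← hR, h₁.action_gen hρ, Matrix.toLin'_apply]
  have hκx : ∀ c : Fin k → ℤ, (κ (∑ a, c a • b a) : Fin n → ℤ) =
      ∑ a, c a • (b.map κ a : Fin n → ℤ) := fun c => by simp
  have hBe : Ab *ᵥ f = f + ∑ a, b.repr x a • (b.map κ a : Fin n → ℤ) := by
    rw [← hκx, b.sum_repr, ← hfx, Matrix.toLin'_apply]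
  have hBb : ∀ c, Ab *ᵥ (b.map κ c : Fin n → ℤ) =
      ∑ a, (R t ^ toAdd (π s)) a c • (b.map κ a : Fin n → ℤ) := fun c => by
    rw [← hκx, ← hRs, ← Matrix.toLin'_apply, Module.Basis.map_apply]
    refine h₂.kerEquiv_action hκ hρ ?_
    rw [hR]
    simp
  obtain ⟨hk, B, hB⟩ := exists_conj_blockOne A _ b e he0 he _ _ hAe hAb
  obtain ⟨_, B', hB'⟩ := exists_conj_blockOne Ab _ (b.map κ) f hf0 hfd _ _ hBe hBb
  exact ⟨k, hk, R t, _, hpos, rfl, _, _, hcop, ⟨B, hB⟩, ⟨B', hB'⟩⟩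

lemma isCyclicExt_zSemidirect {n : ℕ} (A : Matrix (Fin n) (Fin n) ℤ) (hA : IsUnit A.det) :
    IsCyclicExt (G := zSemidirect A hA) (Matrix.toLin' A) SemidirectProduct.inl
      SemidirectProduct.rightHom (SemidirectProduct.inr (ofAdd 1)) where
  inj := SemidirectProduct.inl_injective
  exact g := by
    rw [← MonoidHom.mem_ker, ← SemidirectProduct.range_inl_eq_ker_rightHom]
    rfl
  gen := SemidirectProduct.rightHom_inr _
  conj x := by
    rw [← map_inv, ← SemidirectProduct.inl_aut]
    congr 1

lemma IsCyclicExt.comp_mulEquiv {V G H : Type*} [AddCommGroup V] [Group G] [Group H]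
    {α : Module.End ℤ V} {i : Multiplicative V →* H} {π : H →* Multiplicative ℤ} {t : H}
    (h : IsCyclicExt α i π t) (φ : G ≃* H) :
    IsCyclicExt α (φ.symm.toMonoidHom.comp i) (π.comp φ.toMonoidHom) (φ.symm t) where
  inj := φ.symm.injective.comp h.inj
  exact g := by
    refine (h.exact (φ g)).trans (exists_congr fun x => ?_)
    exact φ.symm_apply_eq.symm
  gen := by simpa using h.gen
  conj x := by
    have := congrArg φ.symm (h.conj x)
    simpa using this

/-- **Lemma (polycyclic case, necessity).** If `ℤ^n ⋊_A ℤ ≅ ℤ^n ⋊_Ā ℤ` and `Ā` is not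
conjugate in `GL_n(ℤ)` to `A` or `A⁻¹`, then `A` and `Ā` are conjugate in `GL_n(ℤ)` to
`[[1,0ᵀ],[u,C]]` and `[[1,0ᵀ],[u,C^q]]` with `C` of finite order `m₀` and
`gcd(q,m₀) = 1`. -/
theorem semidirect_iso_not_conjugate_implies_block_form
    (n : ℕ) (A Ab : Matrix (Fin n) (Fin n) ℤ) (hA : IsUnit A.det) (hAb : IsUnit Ab.det)
    (hiso : Nonempty (zSemidirect A hA ≃* zSemidirect Ab hAb))
    (hnotconj : ¬∃ B : Matrix (Fin n) (Fin n) ℤ, IsUnit B.det ∧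
      (Ab = B * A * B⁻¹ ∨ Ab = B * A⁻¹ * B⁻¹)) :
    ∃ k : ℕ, ∃ hk : k + 1 = n, ∃ C : Matrix (Fin k) (Fin k) ℤ, ∃ m₀ : ℕ,
      0 < m₀ ∧ orderOf C = m₀ ∧
      ∃ u : Fin k → ℤ, ∃ q : ℤ, Int.gcd q m₀ = 1 ∧
        (∃ B : Matrix (Fin n) (Fin n) ℤ, IsUnit B.det ∧
          A = B * Matrix.reindex (finCongr hk) (finCongr hk) (blockOne u C) * B⁻¹) ∧
        (∃ B : Matrix (Fin n) (Fin n) ℤ, IsUnit B.det ∧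
          Ab = B * Matrix.reindex (finCongr hk) (finCongr hk) (blockOne u (C ^ q)) * B⁻¹) := by
  obtain ⟨φ⟩ := hiso
  have h₁ := isCyclicExt_zSemidirect A hA
  have h₂ := (isCyclicExt_zSemidirect Ab hAb).comp_mulEquiv φ
  refine exists_blockOne_of_isCyclicExt h₁ h₂ fun h0 => hnotconj ?_
  obtain ⟨κ, hκ⟩ := h₁.exists_conj_of_linForm_eq_zero h₂ h0
  have hB : IsUnit (LinearMap.toMatrix' (κ : (Fin n → ℤ) →ₗ[ℤ] (Fin n → ℤ))).det := by
    rw [LinearMap.det_toMatrix']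
    exact κ.isUnit_det'
  refine ⟨LinearMap.toMatrix' (κ : (Fin n → ℤ) →ₗ[ℤ] (Fin n → ℤ)), hB, ?_⟩
  set B := LinearMap.toMatrix' (κ : (Fin n → ℤ) →ₗ[ℤ] (Fin n → ℤ)) with hBdef
  have hBκ : ∀ x, κ x = B *ᵥ x := fun x => by
    rw [hBdef, LinearMap.toMatrix'_mulVec, LinearEquiv.coe_coe]
  refine hκ.imp (fun h => ?_) (fun h => ?_)
  · have hm : Ab * B = B * A := Matrix.toLin'.injective <| LinearMap.ext fun x => by
      simpa [hBκ, Matrix.toLin'_mul] using h x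
    rw [← hm, Matrix.mul_assoc, Matrix.mul_nonsing_inv _ hB, Matrix.mul_one]
  · have hm : Ab * (B * A) = B := Matrix.toLin'.injective <| LinearMap.ext fun x => by
      simpa [hBκ, Matrix.toLin'_mul] using h x
    have hm' : Ab * B = B * A⁻¹ := by
      conv_rhs => rw [← hm]
      rw [Matrix.mul_assoc, Matrix.mul_assoc, Matrix.mul_nonsing_inv _ hA, Matrix.mul_one]
    rw [← hm', Matrix.mul_assoc, Matrix.mul_nonsing_inv _ hB, Matrix.mul_one]
end
end

section
/- Let q, m, n ∈ ℤ with m, n > 0 and gcd(q,m) = 1, let u ∈ ℤ^{n-1}, and let C ∈ GL_{n-1}(ℤ) be a matrix of order m. Write A = [[1, 0ᵀ],[u, C]] and Ā = [[1, 0ᵀ],[u, C^q]]. Then the semidirect products ℤ^n ⋊_A ℤ and ℤ^n ⋊_Ā ℤ are isomorphic. -/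
open Matrix

noncomputable section

section SemidirectProductInt

variable {N H : Type*} [Group N] [Group H]

theorem map_zpow_mulAut_apply_eq_conj {α : MulAut N} {f : N →* H} {t : H}
    (h : ∀ p, f (α p) = t * f p * t⁻¹) (z : ℤ) (p : N) :
    f ((α ^ z) p) = t ^ z * f p * (t ^ z)⁻¹ := by
  induction z generalizing p with
  | zero => simp
  | succ k ih =>
    rw [_root_.zpow_add_one, MulAut.mul_apply, ih, h, _root_.zpow_add_one]
    group
  | pred k ih =>
    have h' : f (α⁻¹ p) = t⁻¹ * f p * t := by
      have := h (α⁻¹ p)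
      rw [MulAut.apply_inv_self] at this
      rw [this]
      group
    rw [_root_.zpow_sub_one, MulAut.mul_apply, ih, h', _root_.zpow_sub_one]
    group

/-- The homomorphism out of `N ⋊ ℤ` determined by a homomorphism on `N` and the image of the
generator of `ℤ`. -/
def zpowersLift (α : MulAut N) (f : N →* H) (t : H) (h : ∀ p, f (α p) = t * f p * t⁻¹) :
    SemidirectProduct N (Multiplicative ℤ) (zpowersHom (MulAut N) α) →* H :=
  SemidirectProduct.lift f (zpowersHom H t) fun g => by
    ext p
    simpa [zpowersHom_apply, -map_zpow] using map_zpow_mulAut_apply_eq_conj h g.toAdd p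

theorem zpowersLift_inl (α : MulAut N) (f : N →* H) (t : H)
    (h : ∀ p, f (α p) = t * f p * t⁻¹) (p : N) :
    zpowersLift α f t h (SemidirectProduct.inl p) = f p :=
  SemidirectProduct.lift_inl _ _ _ p

theorem zpowersLift_inr (α : MulAut N) (f : N →* H) (t : H)
    (h : ∀ p, f (α p) = t * f p * t⁻¹) (z : Multiplicative ℤ) :
    zpowersLift α f t h (SemidirectProduct.inr z) = t ^ z.toAdd := by
  simp [zpowersLift, zpowersHom_apply]

end SemidirectProductInt

section BlockMatrix

variable {k : ℕ}

theorem blockOne_mulVec_cons (u : Fin k → ℤ) (C : Matrix (Fin k) (Fin k) ℤ) (a : ℤ)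
    (v : Fin k → ℤ) :
    blockOne u C *ᵥ (Fin.cons a v : Fin (k + 1) → ℤ) = Fin.cons a (a • u + C *ᵥ v) := by
  ext i
  refine Fin.cases ?_ (fun i => ?_) i
  · simp [blockOne, Matrix.mulVec, dotProduct, Fin.sum_univ_succ]
  · simp [blockOne, Matrix.mulVec, dotProduct, Fin.sum_univ_succ, mul_comm]

/-- The automorphism of `ℤ^n`, written multiplicatively, through which `ℤ` acts in
`zSemidirect A hA`. -/
abbrev matMulAut {n : ℕ} (A : Matrix (Fin n) (Fin n) ℤ) (hA : IsUnit A.det) :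
    MulAut (Multiplicative (Fin n → ℤ)) :=
  AddEquiv.toMultiplicative (matAut A hA)

variable {u : Fin k → ℤ} {C : Matrix (Fin k) (Fin k) ℤ}

theorem matMulAut_blockOne_apply (hA : IsUnit (blockOne u C).det) (a : ℤ) (v : Fin k → ℤ) :
    matMulAut (blockOne u C) hA (.ofAdd (Fin.cons a v)) =
      .ofAdd (Fin.cons a (a • u + C *ᵥ v)) :=
  congrArg Multiplicative.ofAdd (blockOne_mulVec_cons u C a v)

theorem matMulAut_blockOne_pow_apply (hA : IsUnit (blockOne u C).det) (r : ℕ) (a : ℤ)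
    (v : Fin k → ℤ) :
    (matMulAut (blockOne u C) hA ^ r) (.ofAdd (Fin.cons a v)) =
      .ofAdd (Fin.cons a (a • ((∑ i ∈ Finset.range r, C ^ i) *ᵥ u) + C ^ r *ᵥ v)) := by
  induction r with
  | zero => simp
  | succ r ih =>
    rw [pow_succ', MulAut.mul_apply, ih, matMulAut_blockOne_apply, geom_sum_succ, pow_succ']
    simp only [Matrix.mulVec_add, Matrix.add_mulVec, Matrix.mulVec_smul, Matrix.one_mulVec,
      Matrix.mulVec_mulVec, smul_add]
    congr 2
    abel

/-- The element of `ℤ^n ⋊ ℤ` with coordinates `(a, v)` and `b`. -/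
def blockElt (hA : IsUnit (blockOne u C).det) (a : ℤ) (v : Fin k → ℤ) (b : ℤ) :
    zSemidirect (blockOne u C) hA :=
  ⟨.ofAdd (Fin.cons a v), .ofAdd b⟩

theorem blockElt_mul_blockElt (hA : IsUnit (blockOne u C).det) (a c : ℤ) (v w : Fin k → ℤ)
    (r : ℕ) (d : ℤ) :
    blockElt hA a v r * blockElt hA c w d =
      blockElt hA (a + c)
        (v + (c • ((∑ i ∈ Finset.range r, C ^ i) *ᵥ u) + C ^ r *ᵥ w)) (r + d) := by
  refine SemidirectProduct.ext ?_ rfl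
  rw [SemidirectProduct.mul_left]
  simp only [blockElt, zpowersHom_apply, toAdd_ofAdd, zpow_natCast]
  rw [matMulAut_blockOne_pow_apply, ← ofAdd_add]
  congr 1
  ext i
  refine Fin.cases ?_ (fun i => ?_) i <;> simp

theorem blockElt_zero_mul_blockElt (hA : IsUnit (blockOne u C).det) (a c : ℤ)
    (v w : Fin k → ℤ) (d : ℤ) :
    blockElt hA a v 0 * blockElt hA c w d = blockElt hA (a + c) (v + w) d := by
  simpa using blockElt_mul_blockElt hA a c v w 0 d

theorem exists_eq_blockElt (hA : IsUnit (blockOne u C).det)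
    (g : zSemidirect (blockOne u C) hA) : ∃ a v b, g = blockElt hA a v b :=
  ⟨g.left.toAdd 0, Fin.tail g.left.toAdd, g.right.toAdd,
    SemidirectProduct.ext (congrArg Multiplicative.ofAdd (Fin.cons_self_tail _).symm) rfl⟩

/-- The inclusion of `ℤ^(n-1)` into `ℤ^n ⋊ ℤ`. -/
def fiberHom (hA : IsUnit (blockOne u C).det) :
    Multiplicative (Fin k → ℤ) →* zSemidirect (blockOne u C) hA :=
  MonoidHom.mk' (fun v => blockElt hA 0 v.toAdd 0) fun v w => by
    simp [blockElt_zero_mul_blockElt]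

theorem fiberHom_ofAdd (hA : IsUnit (blockOne u C).det) (v : Fin k → ℤ) :
    fiberHom hA (.ofAdd v) = blockElt hA 0 v 0 := rfl

/-- The projection of `ℤ^n ⋊ ℤ` onto the first coordinate. -/
def firstCoordHom (hA : IsUnit (blockOne u C).det) :
    zSemidirect (blockOne u C) hA →* Multiplicative ℤ :=
  zpowersLift _ (AddMonoidHom.toMultiplicative (Pi.evalAddMonoidHom (fun _ => ℤ) 0)) 1 fun p => by
    obtain ⟨p, rfl⟩ := Multiplicative.ofAdd.surjective p
    rw [← Fin.cons_self_tail p]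
    have := matMulAut_blockOne_apply hA (p 0) (Fin.tail p)
    simp [matMulAut] at this ⊢
    simp [this]

theorem firstCoordHom_blockElt (hA : IsUnit (blockOne u C).det) (a : ℤ) (v : Fin k → ℤ) (b : ℤ) :
    firstCoordHom hA (blockElt hA a v b) = .ofAdd a := by
  rw [← SemidirectProduct.inl_left_mul_inr_right (blockElt hA a v b), map_mul]
  simp only [firstCoordHom, zpowersLift_inl, zpowersLift_inr, _root_.one_zpow, mul_one]
  rfl

theorem rightHom_blockElt (hA : IsUnit (blockOne u C).det) (a : ℤ) (v : Fin k → ℤ) (b : ℤ) :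
    SemidirectProduct.rightHom (blockElt hA a v b) = .ofAdd b := rfl

theorem commute_blockElt_of_pow_eq_one (hA : IsUnit (blockOne u C).det) {m : ℕ}
    (hm : C ^ m = 1) (y : ℤ) (v w : Fin k → ℤ) :
    Commute (blockElt hA 0 v 0) (blockElt hA y w m) := by
  rw [Commute, SemiconjBy, blockElt_zero_mul_blockElt, blockElt_mul_blockElt, hm]
  simp [add_comm]

/-- The homomorphism `ℤ^n → ℤ^n ⋊ ℤ` extending `fiberHom` and sending the first basis vector to a
given element commuting with the image of `fiberHom`. -/
def extendFiberHom (hA : IsUnit (blockOne u C).det) (e : zSemidirect (blockOne u C) hA)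
    (he : ∀ v, Commute (blockElt hA 0 v 0) e) :
    Multiplicative (Fin (k + 1) → ℤ) →* zSemidirect (blockOne u C) hA :=
  MonoidHom.mk' (fun p => blockElt hA 0 (Fin.tail p.toAdd) 0 * e ^ p.toAdd 0) fun p p' => by
    have h : blockElt hA 0 (Fin.tail (p * p').toAdd) 0 =
        blockElt hA 0 (Fin.tail p.toAdd) 0 * blockElt hA 0 (Fin.tail p'.toAdd) 0 := by
      rw [blockElt_zero_mul_blockElt]
      rfl
    rw [h, toAdd_mul, Pi.add_apply, _root_.zpow_add, mul_assoc, mul_assoc]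
    congr 1
    rw [← mul_assoc, ← mul_assoc, ((he _).zpow_right _).eq]

theorem extendFiberHom_cons (hA : IsUnit (blockOne u C).det)
    (e : zSemidirect (blockOne u C) hA) (he : ∀ v, Commute (blockElt hA 0 v 0) e) (a : ℤ)
    (v : Fin k → ℤ) :
    extendFiberHom hA e he (.ofAdd (Fin.cons a v)) = blockElt hA 0 v 0 * e ^ a := rfl

theorem nonempty_blockOne_mulEquiv {r m : ℕ} {x y : ℤ} {w : Fin k → ℤ}
    (hm : C ^ m = 1) (hxy : r * y - m * x = 1)
    (hw : y • ((∑ i ∈ Finset.range r, C ^ i) *ᵥ u) + C ^ r *ᵥ w =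
      u + w + x • ((∑ i ∈ Finset.range m, C ^ i) *ᵥ u))
    (hA : IsUnit (blockOne u C).det) (hB : IsUnit (blockOne u (C ^ r)).det) :
    Nonempty (zSemidirect (blockOne u C) hA ≃* zSemidirect (blockOne u (C ^ r)) hB) := by
  set e := blockElt hA y w m with he_def
  set t := blockElt hA x 0 r with ht_def
  have he : ∀ v, Commute (blockElt hA 0 v 0) e := fun v =>
    commute_blockElt_of_pow_eq_one hA hm y v w
  have hte : t * e * t⁻¹ = blockElt hA 0 u 0 * e := by
    rw [mul_inv_eq_iff_eq_mul, ht_def, he_def, blockElt_zero_mul_blockElt, blockElt_mul_blockElt,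
      blockElt_mul_blockElt, hw]
    simp [add_comm]
  have htv : ∀ v, t * blockElt hA 0 v 0 * t⁻¹ = blockElt hA 0 (C ^ r *ᵥ v) 0 := fun v => by
    rw [mul_inv_eq_iff_eq_mul, ht_def, blockElt_mul_blockElt, blockElt_zero_mul_blockElt]
    simp
  have hconj : ∀ p, extendFiberHom hA e he (matMulAut (blockOne u (C ^ r)) hB p) =
      t * extendFiberHom hA e he p * t⁻¹ := fun p => by
    obtain ⟨p, rfl⟩ := Multiplicative.ofAdd.surjective p
    rw [← Fin.cons_self_tail p, matMulAut_blockOne_apply, extendFiberHom_cons, extendFiberHom_cons,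
      ← MulAut.conj_apply, map_mul, map_zpow, MulAut.conj_apply, MulAut.conj_apply, hte, htv,
      (he u).mul_zpow, ← mul_assoc]
    congr 1
    rw [← fiberHom_ofAdd, ← fiberHom_ofAdd, ← fiberHom_ofAdd, ofAdd_add, ofAdd_zsmul, map_mul,
      map_zpow, ← map_zpow, ← map_mul, ← map_mul, mul_comm]
  let φ := zpowersLift _ _ t hconj
  have hφ : ∀ a v b, φ (blockElt hB a v b) = blockElt hA 0 v 0 * e ^ a * t ^ b := fun a v b => by
    rw [← SemidirectProduct.inl_left_mul_inr_right (blockElt hB a v b), map_mul, zpowersLift_inl,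
      zpowersLift_inr]
    rfl
  have hfirst : ∀ a v b, firstCoordHom hA (φ (blockElt hB a v b)) = .ofAdd (a * y + b * x) :=
    fun a v b => by
      rw [hφ, map_mul, map_mul, map_zpow, map_zpow, firstCoordHom_blockElt,
        firstCoordHom_blockElt, firstCoordHom_blockElt, ← ofAdd_zsmul, ← ofAdd_zsmul, ← ofAdd_add,
        ← ofAdd_add]
      simp
  have hright : ∀ a v b,
      SemidirectProduct.rightHom (φ (blockElt hB a v b)) = .ofAdd (a * m + b * r) :=
    fun a v b => by
      rw [hφ, map_mul, map_mul, map_zpow, map_zpow, rightHom_blockElt,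
        rightHom_blockElt, rightHom_blockElt, ← ofAdd_zsmul, ← ofAdd_zsmul, ← ofAdd_add,
        ← ofAdd_add]
      simp
  have hfiber : ∀ v, φ (blockElt hB 0 v 0) = blockElt hA 0 v 0 := fun v => by simp [hφ]
  refine ⟨(MulEquiv.ofBijective φ ⟨?_, ?_⟩).symm⟩
  · rw [injective_iff_map_eq_one]
    intro g hg
    obtain ⟨a, v, b, rfl⟩ := exists_eq_blockElt hB g
    have h1 : a * y + b * x = 0 := by
      have := hfirst a v b
      rwa [hg, map_one, eq_comm, ofAdd_eq_one] at this
    have h2 : a * m + b * r = 0 := by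
      have := hright a v b
      rwa [hg, map_one, eq_comm, ofAdd_eq_one] at this
    obtain rfl : a = 0 := by linear_combination (r : ℤ) * h1 - x * h2 - a * hxy
    obtain rfl : b = 0 := by linear_combination y * h2 - m * h1 - b * hxy
    rw [hfiber] at hg
    have hv : v = 0 := by
      have := congrArg (fun g => Fin.tail (SemidirectProduct.left g).toAdd) hg
      exact this
    subst hv
    exact map_one (fiberHom hB)
  · intro g
    obtain ⟨c, v, d, hg⟩ := exists_eq_blockElt hA g
    set g₀ := blockElt hB (r * c - x * d) 0 (y * d - m * c) with hg₀
    obtain ⟨c', v', d', hg'⟩ := exists_eq_blockElt hA (g * (φ g₀)⁻¹)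
    have h1 : c' = 0 := by
      have := congrArg (firstCoordHom hA) hg'
      rw [map_mul, map_inv, hg₀, hfirst, hg, firstCoordHom_blockElt, firstCoordHom_blockElt,
        ← ofAdd_neg, ← ofAdd_add] at this
      have := Multiplicative.ofAdd.injective this
      linear_combination -this - c * hxy
    have h2 : d' = 0 := by
      have := congrArg SemidirectProduct.rightHom hg'
      rw [map_mul, map_inv, hg₀, hright, hg, rightHom_blockElt, rightHom_blockElt,
        ← ofAdd_neg, ← ofAdd_add] at this
      have := Multiplicative.ofAdd.injective this
      linear_combination -this - d * hxy
    subst h1 h2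
    refine ⟨blockElt hB 0 v' 0 * g₀, ?_⟩
    rw [map_mul, hfiber, ← hg', inv_mul_cancel_right]

end BlockMatrix

theorem geom_sum_eq_natCast_add {R : Type*} [Ring R] (c : R) (n : ℕ) :
    ∑ i ∈ Finset.range n, c ^ i =
      n + (c - 1) * ∑ i ∈ Finset.range n, ∑ j ∈ Finset.range i, c ^ j := by
  rw [Finset.mul_sum]
  simp [mul_geom_sum]

theorem exists_pow_sub_one_mul_eq {R : Type*} [Ring R] {c : R} {r : ℕ} (m : ℕ) {x y : ℤ}
    (hr : r.Coprime (orderOf c)) (hxy : r * y - m * x = 1) :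
    ∃ z, (c ^ r - 1) * z =
      1 + x • (∑ i ∈ Finset.range m, c ^ i) - y • ∑ i ∈ Finset.range r, c ^ i := by
  obtain ⟨l, hl⟩ := exists_pow_eq_self_of_coprime hr
  have hc : c - 1 = (c ^ r - 1) * ∑ i ∈ Finset.range l, (c ^ r) ^ i := by rw [mul_geom_sum, hl]
  have hxy' : (1 : R) + x • (m : R) - y • (r : R) = 0 := by
    have := congrArg (Int.cast : ℤ → R) hxy
    push_cast at this
    rw [← this, zsmul_eq_mul, zsmul_eq_mul, (Nat.cast_commute r _).eq, (Nat.cast_commute m _).eq]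
    abel
  refine ⟨(∑ i ∈ Finset.range l, (c ^ r) ^ i) *
    (x • (∑ i ∈ Finset.range m, ∑ j ∈ Finset.range i, c ^ j) -
      y • ∑ i ∈ Finset.range r, ∑ j ∈ Finset.range i, c ^ j), ?_⟩
  rw [← mul_assoc, ← hc, geom_sum_eq_natCast_add c m, geom_sum_eq_natCast_add c r, mul_sub,
    mul_smul_comm, mul_smul_comm, smul_add, smul_add, ← sub_eq_zero]
  rw [← neg_eq_zero, ← hxy']
  abel

theorem nonempty_blockOne_mulEquiv_of_coprime {k r : ℕ} (u : Fin k → ℤ)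
    (C : Matrix (Fin k) (Fin k) ℤ) (hr : r.Coprime (orderOf C))
    (hA : IsUnit (blockOne u C).det) (hB : IsUnit (blockOne u (C ^ r)).det) :
    Nonempty (zSemidirect (blockOne u C) hA ≃* zSemidirect (blockOne u (C ^ r)) hB) := by
  have hxy : (r : ℤ) * r.gcdA (orderOf C) - orderOf C * -r.gcdB (orderOf C) = 1 := by
    have := Nat.gcd_eq_gcd_ab r (orderOf C)
    rw [hr.gcd_eq_one] at this
    push_cast at this
    linarith
  obtain ⟨z, hz⟩ := exists_pow_sub_one_mul_eq (orderOf C) hr hxy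
  refine nonempty_blockOne_mulEquiv (w := z *ᵥ u) (pow_orderOf_eq_one C) hxy ?_ hA hB
  have := congrArg (· *ᵥ u) hz
  simp only [sub_mul, one_mul, Matrix.sub_mulVec, Matrix.add_mulVec, Matrix.smul_mulVec,
    Matrix.one_mulVec, ← Matrix.mulVec_mulVec] at this
  rw [sub_eq_sub_iff_add_eq_add] at this
  rw [add_comm, this]
  abel

theorem Matrix.exists_natCast_zpow_eq {k : ℕ} {C : Matrix (Fin k) (Fin k) ℤ} (hC : 0 < orderOf C)
    {q : ℤ} (hq : Int.gcd q (orderOf C) = 1) :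
    ∃ r : ℕ, r.Coprime (orderOf C) ∧ C ^ q = C ^ r := by
  obtain ⟨c, rfl⟩ : IsUnit C := IsUnit.of_pow_eq_one (pow_orderOf_eq_one C) hC.ne'
  rw [orderOf_units] at *
  have hnn : 0 ≤ q % (orderOf c : ℤ) := Int.emod_nonneg _ (by exact_mod_cast hC.ne')
  refine ⟨(q % (orderOf c : ℤ)).toNat, ?_, ?_⟩
  · rw [← Int.isCoprime_iff_gcd_eq_one] at hq
    rw [← Nat.isCoprime_iff_coprime, Int.toNat_of_nonneg hnn]
    have := hq.add_mul_left_left (-(q / (orderOf c : ℤ)))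
    rwa [mul_neg, ← sub_eq_add_neg, ← Int.emod_def] at this
  · rw [← Matrix.coe_units_zpow, ← zpow_mod_orderOf, ← Units.val_pow_eq_pow_val, ← zpow_natCast,
      Int.toNat_of_nonneg hnn]

/-- **Lemma (polycyclic case, sufficiency).** If `C ∈ GL_{n-1}(ℤ)` has order `m` and
`gcd(q,m) = 1`, then for `A = [[1,0ᵀ],[u,C]]` and `Ā = [[1,0ᵀ],[u,C^q]]` the groups
`ℤ^n ⋊_A ℤ` and `ℤ^n ⋊_Ā ℤ` are isomorphic. -/
theorem block_form_implies_semidirect_iso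
    (q : ℤ) (m n : ℕ) (hm : 0 < m) (hn : 0 < n) (hq : Int.gcd q m = 1)
    (u : Fin (n - 1) → ℤ) (C : Matrix (Fin (n - 1)) (Fin (n - 1)) ℤ)
    (hC : orderOf C = m) :
    ∀ (hA : IsUnit (Matrix.reindex (finCongr (Nat.succ_pred_eq_of_pos hn))
          (finCongr (Nat.succ_pred_eq_of_pos hn)) (blockOne u C)).det)
      (hAb : IsUnit (Matrix.reindex (finCongr (Nat.succ_pred_eq_of_pos hn))
          (finCongr (Nat.succ_pred_eq_of_pos hn)) (blockOne u (C ^ q))).det),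
      Nonempty (zSemidirect _ hA ≃* zSemidirect _ hAb) := by
  intro hA hAb
  subst hC
  obtain ⟨r, hr, hCr⟩ := Matrix.exists_natCast_zpow_eq hm hq
  obtain _ | k := n
  · exact absurd hn (lt_irrefl 0)
  · have key : ∀ (A B : Matrix (Fin (k + 1)) (Fin (k + 1)) ℤ) (hA : IsUnit A.det)
        (hB : IsUnit B.det), A = blockOne u C → B = blockOne u (C ^ r) →
        Nonempty (zSemidirect A hA ≃* zSemidirect B hB) := by
      rintro _ _ hA hB rfl rfl
      exact nonempty_blockOne_mulEquiv_of_coprime u C hr hA hB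
    exact key _ _ hA hAb rfl (by rw [hCr]; rfl)
end
end

section
/- Let D ∈ GL_n(ℚ) be a matrix of finite order m, and let q ∈ ℤ be such that gcd(q,m) = 1. Then D and D^q are conjugate in GL_n(ℚ); that is, there exists B ∈ GL_n(ℚ) with D^q = BDB⁻¹. -/
open Polynomial in
/-- A rational irreducible factor of `X ^ m - 1` vanishes at the `k`-th powers of its roots,
for `k` coprime to `m`. -/
theorem Irreducible.dvd_expand_of_dvd_X_pow_sub_one {m k : ℕ} (hm : 0 < m)
    (hk : k.Coprime m) {p : ℚ[X]} (hp : Irreducible p) (hpm : p ∣ X ^ m - 1) :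
    p ∣ expand ℚ k p := by
  obtain ⟨z, hz⟩ := IsAlgClosed.exists_aeval_eq_zero ℂ p (degree_pos_of_irreducible hp).ne'
  have hzm : z ^ m = 1 := by
    have h := aeval_eq_zero_of_dvd_aeval_eq_zero hpm hz
    rwa [map_sub, map_pow, aeval_X, map_one, sub_eq_zero] at h
  have hd : orderOf z ∣ m := orderOf_dvd_of_pow_eq_one hzm
  have hd0 : 0 < orderOf z := Nat.pos_of_dvd_of_pos hd hm
  have hz₁ : IsPrimitiveRoot z (orderOf z) := IsPrimitiveRoot.orderOf z
  have hz₂ : IsPrimitiveRoot (z ^ k) (orderOf z) :=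
    hz₁.pow_of_coprime k (hk.coprime_dvd_right hd)
  have hmin : minpoly ℚ z = minpoly ℚ (z ^ k) := by
    rw [← cyclotomic_eq_minpoly_rat hz₁ hd0, ← cyclotomic_eq_minpoly_rat hz₂ hd0]
  have hroot : aeval (z ^ k) p = 0 := minpoly.dvd_iff.1 (hmin ▸ minpoly.dvd ℚ z hz)
  have hdvd : p ∣ minpoly ℚ z := by
    rw [← minpoly.eq_of_irreducible hp hz, mul_comm]
    exact (associated_unit_mul_right p _ (isUnit_C.2
      (inv_ne_zero (leadingCoeff_ne_zero.2 hp.ne_zero)).isUnit)).dvd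
  exact hdvd.trans (minpoly.dvd ℚ z (by rw [expand_aeval, hroot]))

open Polynomial in
/-- A prime power factor of `X ^ m - 1` over `ℚ` divides its expansion by any `k` coprime
to `m`. -/
theorem Irreducible.pow_dvd_expand_of_dvd_X_pow_sub_one {m k e : ℕ} (hm : 0 < m)
    (hk : k.Coprime m) {p : ℚ[X]} (hp : Irreducible p) (hpm : p ^ e ∣ X ^ m - 1) :
    p ^ e ∣ expand ℚ k (p ^ e) := by
  rcases Nat.eq_zero_or_pos e with rfl | he
  · simp
  · have h := hp.dvd_expand_of_dvd_X_pow_sub_one hm hk ((dvd_pow_self p he.ne').trans hpm)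
    rw [map_pow]
    exact pow_dvd_pow_of_dvd h e

open Polynomial in
/-- If `f ∣ X ^ m - 1` and `f` divides its expansions by `k` and by an inverse of `k` modulo `m`,
then `X ↦ X ^ k` induces an automorphism of `R[X] ⧸ (f)`. -/
theorem Polynomial.exists_quotient_linearEquiv_X_smul {R : Type*} [CommRing R] {m k l : ℕ}
    (hkl : k * l ≡ 1 [MOD m]) {f : R[X]} (hf : f ∣ X ^ m - 1)
    (hfk : f ∣ expand R k f) (hfl : f ∣ expand R l f) :
    ∃ φ : (R[X] ⧸ Submodule.span R[X] {f}) ≃ₗ[R] (R[X] ⧸ Submodule.span R[X] {f}),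
      ∀ v, φ ((X : R[X]) • v) = (X ^ k : R[X]) • φ v := by
  let I : Ideal R[X] := Ideal.span {f}
  have hXm : (Ideal.Quotient.mk I X) ^ m = 1 := by
    have h := Ideal.Quotient.eq_zero_iff_mem.2 (Ideal.mem_span_singleton.2 hf : _ ∈ I)
    rwa [map_sub, map_pow, map_one, sub_eq_zero] at h
  have hX : (Ideal.Quotient.mk I X) ^ (k * l) = Ideal.Quotient.mk I X := by
    rw [pow_eq_pow_of_modEq hkl hXm, pow_one]
  have hI : ∀ j, f ∣ expand R j f → I ≤ I.comap (expand R j) := fun j hj ↦ by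
    rw [Ideal.span_le, Set.singleton_subset_iff]
    exact Ideal.mem_span_singleton.2 hj
  let a : (R[X] ⧸ I) →ₐ[R] (R[X] ⧸ I) := Ideal.quotientMapₐ I (expand R k) (hI k hfk)
  let b : (R[X] ⧸ I) →ₐ[R] (R[X] ⧸ I) := Ideal.quotientMapₐ I (expand R l) (hI l hfl)
  have ha : ∀ g, a (Ideal.Quotient.mk I g) = Ideal.Quotient.mk I (expand R k g) := fun _ ↦ rfl
  have hb : ∀ g, b (Ideal.Quotient.mk I g) = Ideal.Quotient.mk I (expand R l g) := fun _ ↦ rfl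
  have hab : a.comp b = AlgHom.id R _ := by
    refine Ideal.Quotient.algHom_ext _ (Polynomial.algHom_ext ?_)
    change a (b (Ideal.Quotient.mk I X)) = Ideal.Quotient.mk I X
    rw [hb, expand_X, map_pow, map_pow, ha, expand_X, map_pow, ← pow_mul, hX]
  have hba : b.comp a = AlgHom.id R _ := by
    refine Ideal.Quotient.algHom_ext _ (Polynomial.algHom_ext ?_)
    change b (a (Ideal.Quotient.mk I X)) = Ideal.Quotient.mk I X
    rw [ha, expand_X, map_pow, map_pow, hb, expand_X, map_pow, ← pow_mul, mul_comm, hX]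
  refine ⟨(AlgEquiv.ofAlgHom a b hab hba).toLinearEquiv, fun v ↦ ?_⟩
  obtain ⟨g, rfl⟩ := Ideal.Quotient.mk_surjective v
  change a (Ideal.Quotient.mk I (X * g)) = Ideal.Quotient.mk I (X ^ k) * a (Ideal.Quotient.mk I g)
  rw [ha, ha, map_mul, expand_X, map_mul]

open Polynomial DirectSum in
/-- An endomorphism `T` of finite order `m` of a finite-dimensional rational vector space is
conjugate to `T ^ k` for `k` coprime to `m`. -/
theorem Module.End.exists_linearEquiv_conj_pow {V : Type*} [AddCommGroup V] [Module ℚ V]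
    [Module.Finite ℚ V] {m k : ℕ} (hm : 0 < m) (hk : k.Coprime m) (T : Module.End ℚ V)
    (hT : T ^ m = 1) : ∃ E : V ≃ₗ[ℚ] V, ∀ v, E (T v) = (T ^ k) (E v) := by
  obtain ⟨l, hkl⟩ : ∃ l, k * l ≡ 1 [MOD m] := by
    obtain ⟨l, -, hl⟩ := Nat.exists_mul_mod_eq_of_coprime 1 hk hm.ne'
    exact ⟨l, hl⟩
  have hl : l.Coprime m := by
    have h : (k * l).Coprime m := by
      rw [Nat.Coprime, hkl.gcd_eq, Nat.gcd_one_left]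
    exact h.coprime_mul_left
  let N := Module.AEval' T
  let o : V ≃ₗ[ℚ] N := Module.AEval'.of T
  have hsmul : ∀ (j : ℕ) (v : V), (X ^ j : ℚ[X]) • o v = o ((T ^ j) v) := fun j v ↦
    Module.AEval'.X_pow_smul_of T v j
  have hne : (X ^ m - 1 : ℚ[X]) ≠ 0 := X_pow_sub_C_ne_zero hm 1
  have hkill : ∀ y : N, (X ^ m - 1 : ℚ[X]) • y = 0 := fun y ↦ by
    obtain ⟨v, rfl⟩ := o.surjective y
    rw [sub_smul, hsmul, hT, one_smul, Module.End.one_apply, sub_self]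
  have htors : Module.IsTorsion ℚ[X] N := fun y ↦
    ⟨⟨X ^ m - 1, mem_nonZeroDivisors_of_ne_zero hne⟩, hkill y⟩
  obtain ⟨ι, _, p, hp, e, ⟨ψ⟩⟩ := Module.equiv_directSum_of_isTorsion htors
  classical
  have hdvd : ∀ i, p i ^ e i ∣ X ^ m - 1 := fun i ↦ by
    let w := DirectSum.lof ℚ[X] ι (fun i ↦ ℚ[X] ⧸ Submodule.span ℚ[X] {p i ^ e i}) i
      (Submodule.Quotient.mk 1)
    have hw : (X ^ m - 1 : ℚ[X]) • w = 0 := by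
      rw [← ψ.apply_symm_apply w, ← map_smul, hkill, map_zero]
    rw [← map_smul, ← Submodule.Quotient.mk_smul, smul_eq_mul, mul_one] at hw
    have h0 := DirectSum.of_injective (β := fun i ↦ ℚ[X] ⧸ Submodule.span ℚ[X] {p i ^ e i}) i
      (hw.trans (map_zero _).symm)
    exact Ideal.mem_span_singleton.1 ((Submodule.Quotient.mk_eq_zero _).1 h0)
  choose φ hφ using fun i ↦ Polynomial.exists_quotient_linearEquiv_X_smul hkl (hdvd i)
    ((hp i).pow_dvd_expand_of_dvd_X_pow_sub_one hm hk (hdvd i))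
    ((hp i).pow_dvd_expand_of_dvd_X_pow_sub_one hm hl (hdvd i))
  let Φ : (⨁ i, ℚ[X] ⧸ Submodule.span ℚ[X] {p i ^ e i}) ≃ₗ[ℚ]
      (⨁ i, ℚ[X] ⧸ Submodule.span ℚ[X] {p i ^ e i}) := DFinsupp.mapRange.linearEquiv φ
  have hΦ : ∀ y, Φ ((X : ℚ[X]) • y) = (X ^ k : ℚ[X]) • Φ y := fun y ↦
    DFinsupp.ext fun i ↦ hφ i (y i)
  let ψ' := ψ.restrictScalars ℚ
  refine ⟨o ≪≫ₗ ψ' ≪≫ₗ Φ ≪≫ₗ ψ'.symm ≪≫ₗ o.symm, fun v ↦ ?_⟩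
  change o.symm (ψ.symm (Φ (ψ (o (T v))))) = (T ^ k) (o.symm (ψ.symm (Φ (ψ (o v)))))
  rw [o.symm_apply_eq, ← hsmul, o.apply_symm_apply, ← map_smul, ← hΦ, ← map_smul]
  have h := hsmul 1 v
  rw [pow_one, pow_one] at h
  rw [h]

/-- **Lemma.** If `D ∈ GL_n(ℚ)` has finite order `m` and `gcd(q,m) = 1`, then `D` and
`D^q` are conjugate in `GL_n(ℚ)`. -/
theorem finite_order_matrix_conjugate_pow
    (n : ℕ) (D : Matrix (Fin n) (Fin n) ℚ) (m : ℕ) (hm : 0 < m) (hD : orderOf D = m)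
    (q : ℤ) (hq : Int.gcd q m = 1) :
    ∃ B : Matrix (Fin n) (Fin n) ℚ, IsUnit B.det ∧ D ^ q = B * D * B⁻¹ := by
  have hDm : D ^ m = 1 := hD ▸ pow_orderOf_eq_one D
  obtain ⟨k, hk⟩ := Int.eq_ofNat_of_zero_le (Int.emod_nonneg q (Int.natCast_ne_zero.2 hm.ne'))
  have hcop : k.Coprime m := by
    rw [Nat.Coprime, ← Int.gcd_natCast_natCast, ← hk, ← hq]
    exact Int.gcd_emod q m
  have hpow : D ^ q = D ^ k := by
    obtain ⟨u, hu⟩ : IsUnit D := IsUnit.of_pow_eq_one hDm hm.ne'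
    have hum : orderOf u = m := by rw [← orderOf_units, hu, hD]
    rw [← hu, ← Matrix.coe_units_zpow, ← zpow_mod_orderOf, hum, hk, zpow_natCast,
      Units.val_pow_eq_pow_val]
  obtain ⟨E, hE⟩ := Module.End.exists_linearEquiv_conj_pow hm hcop (Matrix.toLin' D)
    (by rw [← Matrix.toLin'_pow, hDm, Matrix.toLin'_one]; rfl)
  have hB : IsUnit (LinearMap.toMatrix' (E : (Fin n → ℚ) →ₗ[ℚ] Fin n → ℚ)).det := by
    rw [LinearMap.det_toMatrix']
    exact E.isUnit_det'
  refine ⟨_, hB, ?_⟩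
  have hcomm : LinearMap.toMatrix' (E : (Fin n → ℚ) →ₗ[ℚ] Fin n → ℚ) * D =
      D ^ k * LinearMap.toMatrix' (E : (Fin n → ℚ) →ₗ[ℚ] Fin n → ℚ) := by
    apply Matrix.toLin'.injective
    refine LinearMap.ext fun v ↦ ?_
    rw [Matrix.toLin'_mul, Matrix.toLin'_mul, Matrix.toLin'_toMatrix', Matrix.toLin'_pow]
    exact hE v
  rw [hpow, hcomm, Matrix.mul_nonsing_inv_cancel_right _ _ hB]
end
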